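/- arXiv:math/0406344 — 3 statements merged into one kernel-verified Lean document; each statement's English description precedes it below -/
import Mathlib

section
/- Fix α with −1 < α < ∞ and λ ∈ D∖{0}, and let φ_{λ,α} be the extremal function φ_{λ,α}(z) = (1 − (1−|λ|²)^{α+2})^{−1/2} · (1 − (1−|λ|²)^{α+2}/(1 − z·conj(λ))^{α+2}). Then for every bounded (complex-valued) harmonic function h on D, ∫_D h(z) |φ_{λ,α}(z)|² (α+1)(1−|z|²)^α dΣ(z) = h(0). -/
open Complex MeasureTheory Metric Set

noncomputable section

/-- The open unit disk in ℂ. -/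
def unitDisk : Set ℂ := Metric.ball 0 1

/-- The closed unit disk in ℂ. -/
def closedDisk : Set ℂ := Metric.closedBall 0 1

/-- The unit circle in ℂ. -/
def unitCircle : Set ℂ := Metric.sphere 0 1

/-- The normalized area measure dΣ = dx dy / π on ℂ. -/
def dSigma : Measure ℂ := (ENNReal.ofReal (1 / Real.pi)) • (volume : Measure ℂ)

/-- The normalized Laplacian Δ = (1/4)(∂²ₓ + ∂²_y) of a real-valued function on ℂ. -/
def lapR (u : ℂ → ℝ) (z : ℂ) : ℝ :=
  (1/4) * (fderiv ℝ (fun w => fderiv ℝ u w 1) z 1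
    + fderiv ℝ (fun w => fderiv ℝ u w Complex.I) z Complex.I)

/-- The normalized Laplacian Δ = (1/4)(∂²ₓ + ∂²_y) of a complex-valued function on ℂ. -/
def lapC (u : ℂ → ℂ) (z : ℂ) : ℂ :=
  (1/4) * (fderiv ℝ (fun w => fderiv ℝ u w 1) z 1
    + fderiv ℝ (fun w => fderiv ℝ u w Complex.I) z Complex.I)

/-- Membership in the weighted Bergman space A²(𝔻, ω): holomorphic on the unit disk
and square integrable against the weight ω with respect to dΣ. -/
def MemA2 (ω : ℂ → ℝ) (f : ℂ → ℂ) : Prop :=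
  DifferentiableOn ℂ f unitDisk ∧
    IntegrableOn (fun z => ‖f z‖ ^ 2 * ω z) unitDisk dSigma

/-- `k` reproduces at `w` for the weight `ω`. -/
def Reproduces (ω : ℂ → ℝ) (k : ℂ → ℂ) (w : ℂ) : Prop :=
  MemA2 ω k ∧ ∀ f : ℂ → ℂ, MemA2 ω f →
    ∫ z in unitDisk, f z * (starRingEnd ℂ) (k z) * (ω z : ℂ) ∂dSigma = f w

/-- A bounded (complex-valued) harmonic function on the unit disk. -/
def BoundedHarmonicC (h : ℂ → ℂ) : Prop :=
  ContDiffOn ℝ 2 h unitDisk ∧ (∀ z ∈ unitDisk, lapC h z = 0) ∧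
    ∃ M : ℝ, ∀ z ∈ unitDisk, ‖h z‖ ≤ M

/-- A bounded real-valued harmonic function on the unit disk. -/
def BoundedHarmonicR (h : ℂ → ℝ) : Prop :=
  ContDiffOn ℝ 2 h unitDisk ∧ (∀ z ∈ unitDisk, lapR h z = 0) ∧
    ∃ M : ℝ, ∀ z ∈ unitDisk, |h z| ≤ M


open Filter Topology

lemma radial_facts (α : ℝ) (hα : -1 < α) :
    IntegrableOn (fun r : ℝ => r * ((α + 1) * (1 - r ^ 2) ^ α)) (Ioo 0 1) ∧
    ∫ r in Ioo (0:ℝ) 1, r * ((α + 1) * (1 - r ^ 2) ^ α) = 1 / 2 := by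
  have hcont : ContinuousOn (fun r : ℝ => -(1/2) * (1 - r ^ 2) ^ (α + 1)) (Icc 0 1) := by
    apply ContinuousOn.mul continuousOn_const
    apply ContinuousOn.rpow_const (by fun_prop)
    intro x _
    right; linarith
  have hder : ∀ x ∈ Ioo (0:ℝ) 1, HasDerivAt (fun r : ℝ => -(1/2) * (1 - r ^ 2) ^ (α + 1))
      (x * ((α + 1) * (1 - x ^ 2) ^ α)) x := by
    intro x hx
    have h1 : 0 < 1 - x ^ 2 := by nlinarith [hx.1, hx.2]
    have h2 : HasDerivAt (fun r : ℝ => 1 - r ^ 2) (-(2 * x)) x := by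
      simpa using ((hasDerivAt_id x).pow 2).const_sub 1
    have h3 := (h2.rpow_const (p := α + 1) (Or.inl h1.ne')).const_mul (-(1/2))
    refine h3.congr_deriv ?_
    rw [add_sub_cancel_right]; ring
  have hpos : ∀ x ∈ Ioo (0:ℝ) 1, 0 ≤ x * ((α + 1) * (1 - x ^ 2) ^ α) := by
    intro x hx
    have h1 : 0 < 1 - x ^ 2 := by nlinarith [hx.1, hx.2]
    have := hx.1
    have : 0 < α + 1 := by linarith
    positivity
  have hint := intervalIntegral.integrableOn_deriv_of_nonneg hcont hder hpos
  refine ⟨hint.mono_set Ioo_subset_Ioc_self, ?_⟩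
  rw [← integral_Ioc_eq_integral_Ioo, ← intervalIntegral.integral_of_le zero_le_one,
    intervalIntegral.integral_eq_sub_of_hasDerivAt_of_le zero_le_one hcont hder
      ((intervalIntegrable_iff_integrableOn_Ioc_of_le zero_le_one).2 hint)]
  have : α + 1 ≠ 0 := by linarith
  simp [Real.zero_rpow this]

lemma weight_integrable (α : ℝ) (hα : -1 < α) :
    IntegrableOn (fun z : ℂ => (α + 1) * (1 - ‖z‖ ^ 2) ^ α) (ball 0 1) := by
  have := (integrableOn_fun_norm_addHaar (E := ℂ) volume
    (f := fun r : ℝ => (α + 1) * (1 - r ^ 2) ^ α) (r := 1)).2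
  apply this
  simpa using (radial_facts α hα).1

lemma mean_circle (f : ℂ → ℂ) (hf : DifferentiableOn ℂ f (ball 0 1)) (r : ℝ) (hr : r ∈ Ioo (0:ℝ) 1) :
    ∫ θ in Ioo (-Real.pi) Real.pi, f (Complex.polarCoord.symm (r, θ)) = 2 * Real.pi * f 0 := by
  have h1 : DiffContOnCl ℂ f (ball 0 |r|) := by
    apply DifferentiableOn.diffContOnCl
    apply hf.mono
    rw [abs_of_pos hr.1]
    exact closure_ball_subset_closedBall.trans (closedBall_subset_ball hr.2)
  have h2 := h1.circleAverage
  rw [Real.circleAverage_def] at h2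
  have h3 : ∀ θ : ℝ, Complex.polarCoord.symm (r, θ) = circleMap 0 r θ := by
    intro θ
    simp [circleMap, Complex.exp_mul_I]
  simp_rw [h3]
  rw [← integral_Ioc_eq_integral_Ioo, ← intervalIntegral.integral_of_le (by linarith [Real.pi_pos])]
  have hper : Function.Periodic (fun θ => f (circleMap 0 r θ)) (2 * Real.pi) := by
    intro θ
    simp only [periodic_circleMap 0 r θ]
  have h4 := hper.intervalIntegral_add_eq (-Real.pi) 0
  rw [show -Real.pi + 2 * Real.pi = Real.pi by ring, zero_add] at h4
  rw [h4, ← h2]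
  have := Real.pi_ne_zero
  simp only [Complex.real_smul]
  push_cast
  field_simp

lemma mean_value (α : ℝ) (hα : -1 < α) (f : ℂ → ℂ) (hf : DifferentiableOn ℂ f (ball 0 1))
    (M : ℝ) (hM : ∀ z ∈ ball (0:ℂ) 1, ‖f z‖ ≤ M) :
    ∫ z in ball (0:ℂ) 1, f z * (((α + 1) * (1 - ‖z‖ ^ 2) ^ α : ℝ) : ℂ) = Real.pi * f 0 := by
  rw [← integral_indicator measurableSet_ball, ← Complex.integral_comp_polarCoord_symm]
  have hsub : Ioo (0:ℝ) 1 ×ˢ Ioo (-Real.pi) Real.pi ⊆ polarCoord.target := by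
    rintro ⟨r, θ⟩ ⟨h1, h2⟩
    exact ⟨h1.1, h2⟩
  rw [setIntegral_eq_of_subset_of_forall_sdiff_eq_zero polarCoord.open_target.measurableSet hsub]
  swap
  · rintro ⟨r, θ⟩ ⟨⟨h1, h2⟩, h3⟩
    rw [indicator_of_notMem, smul_zero]
    intro h4
    rw [mem_ball_zero_iff, Complex.norm_polarCoord_symm] at h4
    exact h3 ⟨⟨h1, (abs_lt.1 h4).2⟩, h2⟩
  have hmem : ∀ p ∈ Ioo (0:ℝ) 1 ×ˢ Ioo (-Real.pi) Real.pi,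
      Complex.polarCoord.symm p ∈ ball (0:ℂ) 1 := by
    intro p hp
    rw [mem_ball_zero_iff, Complex.norm_polarCoord_symm, abs_of_pos hp.1.1]
    exact hp.1.2
  have hms : MeasurableSet (Ioo (0:ℝ) 1 ×ˢ Ioo (-Real.pi) Real.pi) :=
    measurableSet_Ioo.prod measurableSet_Ioo
  have hcongr : EqOn (fun p : ℝ × ℝ => p.1 • (ball (0:ℂ) 1).indicator
      (fun z => f z * (((α + 1) * (1 - ‖z‖ ^ 2) ^ α : ℝ) : ℂ)) (Complex.polarCoord.symm p))
      (fun p => ((p.1 * ((α + 1) * (1 - p.1 ^ 2) ^ α) : ℝ) : ℂ) * f (Complex.polarCoord.symm p))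
      (Ioo (0:ℝ) 1 ×ˢ Ioo (-Real.pi) Real.pi) := by
    intro p hp
    simp only [indicator_of_mem (hmem p hp), Complex.norm_polarCoord_symm, sq_abs,
      Complex.real_smul]
    push_cast
    ring
  rw [setIntegral_congr_fun hms hcongr]
  have hcs : Continuous (fun p : ℝ × ℝ => Complex.polarCoord.symm p) := by
    simp only [Complex.polarCoord_symm_apply]
    fun_prop
  have hR := radial_facts α hα
  have hint : IntegrableOn (fun p : ℝ × ℝ => ((p.1 * ((α + 1) * (1 - p.1 ^ 2) ^ α) : ℝ) : ℂ) *
      f (Complex.polarCoord.symm p)) (Ioo (0:ℝ) 1 ×ˢ Ioo (-Real.pi) Real.pi) (volume.prod volume) := by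
    have h1 : IntegrableOn (fun p : ℝ × ℝ => ((p.1 * ((α + 1) * (1 - p.1 ^ 2) ^ α) : ℝ) : ℂ))
        (Ioo (0:ℝ) 1 ×ˢ Ioo (-Real.pi) Real.pi) (volume.prod volume) := by
      rw [IntegrableOn, ← Measure.prod_restrict]
      have hR1 : Integrable (fun r : ℝ => ((r * ((α + 1) * (1 - r ^ 2) ^ α) : ℝ) : ℂ))
          (volume.restrict (Ioo (0:ℝ) 1)) := Integrable.ofReal hR.1
      have := (Integrable.mul_prod (μ := volume.restrict (Ioo (0:ℝ) 1))
        (ν := volume.restrict (Ioo (-Real.pi) Real.pi)) (f := fun r : ℝ => ((r * ((α + 1) * (1 - r ^ 2) ^ α) : ℝ) : ℂ))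
        (g := fun _ => (1:ℂ)) hR1 (integrable_const _))
      simpa using this
    refine Integrable.mul_bdd (c := M) h1 ?_ ?_
    · exact (hf.continuousOn.comp hcs.continuousOn hmem).aestronglyMeasurable hms
    · exact (ae_restrict_iff' hms).2 (Eventually.of_forall fun p hp => hM _ (hmem p hp))
  rw [Measure.volume_eq_prod, setIntegral_prod _ hint]
  have : ∀ r ∈ Ioo (0:ℝ) 1, ∫ θ in Ioo (-Real.pi) Real.pi,
      ((r * ((α + 1) * (1 - r ^ 2) ^ α) : ℝ) : ℂ) * f (Complex.polarCoord.symm (r, θ)) =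
      ((r * ((α + 1) * (1 - r ^ 2) ^ α) : ℝ) : ℂ) * (2 * Real.pi * f 0) := by
    intro r hr
    rw [integral_const_mul, mean_circle f hf r hr]
  rw [setIntegral_congr_fun measurableSet_Ioo this, integral_mul_const, integral_complex_ofReal, hR.2]
  push_cast
  ring

lemma mob_den {lam z : ℂ} (hlam : ‖lam‖ < 1) (hz : ‖z‖ < 1) :
    0 < (1 - z * (starRingEnd ℂ) lam).re := by
  have h1 : ‖z * (starRingEnd ℂ) lam‖ < 1 := by
    rw [norm_mul, RCLike.norm_conj]
    nlinarith [norm_nonneg z, norm_nonneg lam]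
  have := (Complex.re_le_norm (z * (starRingEnd ℂ) lam))
  simp only [Complex.sub_re, Complex.one_re]
  linarith

lemma mob_den_ne {lam z : ℂ} (hlam : ‖lam‖ < 1) (hz : ‖z‖ < 1) :
    1 - z * (starRingEnd ℂ) lam ≠ 0 := by
  intro h
  have := mob_den hlam hz
  rw [h] at this
  simp at this

/-- The disk involution exchanging `0` and `lam`. -/
def mob (lam z : ℂ) : ℂ := (lam - z) / (1 - z * (starRingEnd ℂ) lam)

lemma mob_norm {lam z : ℂ} (hlam : ‖lam‖ < 1) (hz : ‖z‖ < 1) :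
    1 - ‖mob lam z‖ ^ 2 =
      (1 - ‖lam‖ ^ 2) * (1 - ‖z‖ ^ 2) / ‖1 - z * (starRingEnd ℂ) lam‖ ^ 2 := by
  have h := mob_den_ne hlam hz
  have h' : ‖1 - z * (starRingEnd ℂ) lam‖ ^ 2 ≠ 0 := by simpa using h
  rw [mob, norm_div, div_pow, eq_div_iff h', sub_mul, div_mul_cancel₀ _ h']
  simp only [← Complex.normSq_eq_norm_sq, Complex.normSq_apply, Complex.sub_re, Complex.sub_im,
    Complex.mul_re, Complex.mul_im, Complex.conj_re, Complex.conj_im, Complex.one_re, Complex.one_im]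
  ring

lemma mob_mem {lam z : ℂ} (hlam : ‖lam‖ < 1) (hz : ‖z‖ < 1) : ‖mob lam z‖ < 1 := by
  have h := mob_norm hlam hz
  have h' : 0 < ‖1 - z * (starRingEnd ℂ) lam‖ := norm_pos_iff.2 (mob_den_ne hlam hz)
  have h1 : 0 < 1 - ‖lam‖ ^ 2 := by nlinarith [norm_nonneg lam]
  have h2 : 0 < 1 - ‖z‖ ^ 2 := by nlinarith [norm_nonneg z]
  have h3 : 0 < 1 - ‖mob lam z‖ ^ 2 := by rw [h]; positivity
  nlinarith [norm_nonneg (mob lam z)]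

lemma mob_den_mob {lam z : ℂ} (hlam : ‖lam‖ < 1) (hz : ‖z‖ < 1) :
    1 - mob lam z * (starRingEnd ℂ) lam =
      ((1 - ‖lam‖ ^ 2 : ℝ) : ℂ) / (1 - z * (starRingEnd ℂ) lam) := by
  have h := mob_den_ne hlam hz
  have h2 : lam * (starRingEnd ℂ) lam = ((‖lam‖ ^ 2 : ℝ) : ℂ) := by
    rw [Complex.mul_conj, Complex.normSq_eq_norm_sq]
  rw [mob, eq_div_iff h, sub_mul, div_mul_eq_mul_div, div_mul_cancel₀ _ h]
  push_cast at h2 ⊢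
  linear_combination -h2

lemma mob_mob {lam z : ℂ} (hlam : ‖lam‖ < 1) (hz : ‖z‖ < 1) : mob lam (mob lam z) = z := by
  have h := mob_den_ne hlam hz
  have h0 := mob_den_ne hlam (mob_mem hlam hz)
  have h3 := mob_den_mob hlam hz
  have h2 : lam * (starRingEnd ℂ) lam = ((‖lam‖ ^ 2 : ℝ) : ℂ) := by
    rw [Complex.mul_conj, Complex.normSq_eq_norm_sq]
  conv_lhs => rw [mob]
  rw [div_eq_iff h0, h3, mob]
  field_simp
  push_cast at h2 ⊢
  linear_combination -z * h2

lemma mob_deriv {lam z : ℂ} (hlam : ‖lam‖ < 1) (hz : ‖z‖ < 1) :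
    HasDerivAt (mob lam) (-((1 - ‖lam‖ ^ 2 : ℝ) : ℂ) / (1 - z * (starRingEnd ℂ) lam) ^ 2) z := by
  have h := mob_den_ne hlam hz
  have h2 : lam * (starRingEnd ℂ) lam = ((‖lam‖ ^ 2 : ℝ) : ℂ) := by
    rw [Complex.mul_conj, Complex.normSq_eq_norm_sq]
  have h4 := ((hasDerivAt_id z).const_sub lam).div
    (((hasDerivAt_id z).mul_const ((starRingEnd ℂ) lam)).const_sub 1) h
  refine h4.congr_deriv ?_
  congr 1
  simp only [id]
  push_cast at h2 ⊢
  linear_combination h2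

lemma det_mul_clm (c : ℂ) :
    (((ContinuousLinearMap.toSpanSingleton ℂ c).restrictScalars ℝ : ℂ →L[ℝ] ℂ)).det = ‖c‖ ^ 2 := by
  simp [ContinuousLinearMap.det, LinearMap.det_restrictScalars,
      Algebra.norm_complex_eq, Complex.normSq_eq_norm_sq]

lemma mobius_mean (α : ℝ) (hα : -1 < α) (lam : ℂ) (hlam : ‖lam‖ < 1) (g : ℂ → ℂ)
    (hg : DifferentiableOn ℂ g (ball 0 1)) (M : ℝ) (hM : ∀ z ∈ ball (0:ℂ) 1, ‖g z‖ ≤ M) :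
    ∫ z in ball (0:ℂ) 1, g z * ((‖1 - z * (starRingEnd ℂ) lam‖ ^ (-(2 * (α + 2))) *
        ((α + 1) * (1 - ‖z‖ ^ 2) ^ α) : ℝ) : ℂ) =
      Real.pi * g lam / (((1 - ‖lam‖ ^ 2) ^ (α + 2) : ℝ) : ℂ) := by
  have hb : ∀ z ∈ ball (0:ℂ) 1, ‖z‖ < 1 := fun z hz => by simpa using hz
  have himg : mob lam '' ball (0:ℂ) 1 = ball 0 1 := by
    apply Subset.antisymm
    · rintro _ ⟨z, hz, rfl⟩
      simpa using mob_mem hlam (hb z hz)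
    · intro z hz
      exact ⟨mob lam z, by simpa using mob_mem hlam (hb z hz), mob_mob hlam (hb z hz)⟩
  have hinj : InjOn (mob lam) (ball (0:ℂ) 1) := by
    intro z hz w hw h
    rw [← mob_mob hlam (hb z hz), h, mob_mob hlam (hb w hw)]
  have hder : ∀ z ∈ ball (0:ℂ) 1, HasFDerivWithinAt (mob lam)
      ((ContinuousLinearMap.toSpanSingleton ℂ
        (-((1 - ‖lam‖ ^ 2 : ℝ) : ℂ) / (1 - z * (starRingEnd ℂ) lam) ^ 2)).restrictScalars ℝ)
      (ball (0:ℂ) 1) z := fun z hz =>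
    ((mob_deriv hlam (hb z hz)).hasFDerivAt.restrictScalars ℝ).hasFDerivWithinAt
  have hmean := mean_value α hα (fun z => g (mob lam z))
    (hg.comp (fun z hz => (mob_deriv hlam (hb z hz)).differentiableAt.differentiableWithinAt)
      (fun z hz => by simpa using mob_mem hlam (hb z hz))) M
    (fun z hz => hM _ (by simpa using mob_mem hlam (hb z hz)))
  have h0 : mob lam 0 = lam := by simp [mob]
  rw [h0] at hmean
  conv_lhs => rw [← himg]
  rw [integral_image_eq_integral_abs_det_fderiv_smul volume measurableSet_ball hder hinj,
    ← hmean, ← integral_div]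
  apply setIntegral_congr_fun measurableSet_ball
  intro z hz
  have hz' := hb z hz
  have hd : 0 < ‖1 - z * (starRingEnd ℂ) lam‖ := norm_pos_iff.2 (mob_den_ne hlam hz')
  have hl : 0 < 1 - ‖lam‖ ^ 2 := by nlinarith [norm_nonneg lam]
  have h2 : 0 < 1 - ‖z‖ ^ 2 := by nlinarith [norm_nonneg z]
  simp only [det_mul_clm, mob_norm hlam hz', mob_den_mob hlam hz', Complex.real_smul]
  rw [mul_left_comm, mul_div_assoc (g (mob lam z)), ← Complex.ofReal_mul, ← Complex.ofReal_div]
  congr 2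
  rw [norm_div, norm_div, norm_neg, norm_pow, Complex.norm_of_nonneg hl.le, abs_of_nonneg (by positivity)]
  set d := ‖1 - z * (starRingEnd ℂ) lam‖
  set s := 1 - ‖lam‖ ^ 2
  set t := 1 - ‖z‖ ^ 2
  have e1 : (s / d) ^ (-(2 * (α + 2))) = (d ^ 2 * d ^ 2 * (d ^ α) ^ 2) / (s ^ 2 * (s ^ (α + 2)) * s ^ α) := by
    rw [Real.rpow_neg (by positivity), Real.div_rpow hl.le hd.le, inv_div]
    congr 1
    · rw [show (2 * (α + 2)) = α + α + 2 + 2 by ring]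
      rw [Real.rpow_add hd, Real.rpow_add hd, Real.rpow_add hd, Real.rpow_two]; ring
    · rw [show (2 * (α + 2)) = 2 + (α + 2) + α by ring]
      rw [Real.rpow_add hl, Real.rpow_add hl, Real.rpow_two]
  have e2 : (s * t / d ^ 2) ^ α = s ^ α * t ^ α / (d ^ α) ^ 2 := by
    rw [Real.div_rpow (by positivity) (by positivity), Real.mul_rpow hl.le h2.le,
      ← Real.rpow_natCast_mul hd.le, mul_comm ((2:ℕ):ℝ), Real.rpow_mul_natCast hd.le]
  rw [e1, e2]
  have p1 : 0 < s ^ α := Real.rpow_pos_of_pos hl _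
  have p2 : 0 < d ^ α := Real.rpow_pos_of_pos hd _
  have p3 : 0 < s ^ (α + 2) := Real.rpow_pos_of_pos hl _
  field_simp

lemma bdd_integrable (α : ℝ) (hα : -1 < α) (f : ℂ → ℂ) (hf : ContinuousOn f (ball 0 1))
    (M : ℝ) (hM : ∀ z ∈ ball (0:ℂ) 1, ‖f z‖ ≤ M) :
    IntegrableOn (fun z => f z * (((α + 1) * (1 - ‖z‖ ^ 2) ^ α : ℝ) : ℂ)) (ball 0 1) := by
  refine Integrable.bdd_mul (c := M) (Integrable.ofReal (weight_integrable α hα)) ?_ ?_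
  · exact hf.aestronglyMeasurable measurableSet_ball
  · exact (ae_restrict_iff' measurableSet_ball).2 (Eventually.of_forall hM)

/-- The reciprocal of the kernel. -/
def recK (α : ℝ) (lam z : ℂ) : ℂ := (1 - z * (starRingEnd ℂ) lam) ^ ((α : ℂ) + 2)

lemma recK_norm (α : ℝ) (lam z : ℂ) :
    ‖recK α lam z‖ = ‖1 - z * (starRingEnd ℂ) lam‖ ^ (α + 2) := by
  rw [recK, ← Complex.norm_cpow_real]
  push_cast
  rfl

lemma recK_diff (α : ℝ) {lam : ℂ} (hlam : ‖lam‖ < 1) :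
    DifferentiableOn ℂ (recK α lam) (ball 0 1) := by
  intro z hz
  apply DifferentiableAt.differentiableWithinAt
  have hz' : ‖z‖ < 1 := by simpa using hz
  apply DifferentiableAt.cpow (by fun_prop) (by fun_prop)
  exact Or.inl (mob_den hlam hz')

lemma recK_le (α : ℝ) (hα : -1 < α) {lam z : ℂ} (hlam : ‖lam‖ < 1) (hz : ‖z‖ < 1) :
    ‖recK α lam z‖ ≤ 2 ^ (α + 2) := by
  rw [recK_norm]
  apply Real.rpow_le_rpow (norm_nonneg _) _ (by linarith)
  refine (norm_sub_le _ _).trans ?_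
  rw [norm_mul, RCLike.norm_conj, norm_one]
  nlinarith [norm_nonneg z, norm_nonneg lam]

lemma recK_ge (α : ℝ) (hα : -1 < α) {lam z : ℂ} (hlam : ‖lam‖ < 1) (hz : ‖z‖ < 1) :
    (1 - ‖lam‖) ^ (α + 2) ≤ ‖recK α lam z‖ := by
  rw [recK_norm]
  apply Real.rpow_le_rpow (by linarith) _ (by linarith)
  have := norm_sub_norm_le (1:ℂ) (z * (starRingEnd ℂ) lam)
  rw [norm_mul, RCLike.norm_conj, norm_one] at this
  nlinarith [norm_nonneg z, norm_nonneg lam]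

lemma recK_ne (α : ℝ) (hα : -1 < α) {lam z : ℂ} (hlam : ‖lam‖ < 1) (hz : ‖z‖ < 1) :
    recK α lam z ≠ 0 := by
  have := recK_ge α hα hlam hz
  have h2 : 0 < (1 - ‖lam‖) ^ (α + 2) := Real.rpow_pos_of_pos (by linarith) _
  exact norm_pos_iff.1 (h2.trans_le this)

lemma recK_zero (α : ℝ) (lam : ℂ) : recK α lam 0 = 1 := by simp [recK]

lemma recK_lam (α : ℝ) {lam : ℂ} (hlam : ‖lam‖ < 1) :
    recK α lam lam = (((1 - ‖lam‖ ^ 2) ^ (α + 2) : ℝ) : ℂ) := by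
  rw [recK, Complex.mul_conj, Complex.normSq_eq_norm_sq,
    Complex.ofReal_cpow (by nlinarith [norm_nonneg lam])]
  push_cast
  rfl

/-- The unnormalized extremal function. -/
def extQ (α : ℝ) (lam z : ℂ) : ℂ := 1 - (((1 - ‖lam‖ ^ 2) ^ (α + 2) : ℝ) : ℂ) / recK α lam z

lemma extQ_diff (α : ℝ) (hα : -1 < α) {lam : ℂ} (hlam : ‖lam‖ < 1) :
    DifferentiableOn ℂ (extQ α lam) (ball 0 1) := by
  apply DifferentiableOn.const_sub
  apply DifferentiableOn.div (by fun_prop) (recK_diff α hlam)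
  intro z hz
  exact recK_ne α hα hlam (by simpa using hz)

lemma extQ_bdd (α : ℝ) (hα : -1 < α) {lam : ℂ} (hlam : ‖lam‖ < 1) :
    ∃ B : ℝ, 0 ≤ B ∧ ∀ z ∈ ball (0:ℂ) 1, ‖extQ α lam z‖ ≤ B := by
  have h2 : 0 < (1 - ‖lam‖) ^ (α + 2) := Real.rpow_pos_of_pos (by linarith) _
  refine ⟨1 + ‖(((1 - ‖lam‖ ^ 2) ^ (α + 2) : ℝ) : ℂ)‖ / (1 - ‖lam‖) ^ (α + 2), by positivity, ?_⟩
  intro z hz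
  refine (norm_sub_le _ _).trans ?_
  rw [norm_div, norm_one]
  gcongr
  exact recK_ge α hα hlam (by simpa using hz)

lemma core_analytic (α : ℝ) (hα : -1 < α) (lam : ℂ) (hlam : ‖lam‖ < 1) (f : ℂ → ℂ)
    (hf : DifferentiableOn ℂ f (ball 0 1)) (M : ℝ) (hM : ∀ z ∈ ball (0:ℂ) 1, ‖f z‖ ≤ M) :
    ∫ z in ball (0:ℂ) 1, f z * ((‖extQ α lam z‖ ^ 2 * ((α + 1) * (1 - ‖z‖ ^ 2) ^ α) : ℝ) : ℂ) =
      Real.pi * (1 - (((1 - ‖lam‖ ^ 2) ^ (α + 2) : ℝ) : ℂ)) * f 0 := by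
  obtain ⟨B, hB0, hB⟩ := extQ_bdd α hα hlam
  have hl : 0 < 1 - ‖lam‖ ^ 2 := by nlinarith [norm_nonneg lam]
  have hs : 0 < (1 - ‖lam‖ ^ 2) ^ (α + 2) := Real.rpow_pos_of_pos hl _
  have h2 : 0 < (1 - ‖lam‖) ^ (α + 2) := Real.rpow_pos_of_pos (by linarith) _
  have hM0 : 0 ≤ M := (norm_nonneg _).trans (hM 0 (by simp))
  have hlam' : lam ∈ ball (0:ℂ) 1 := by simpa using hlam
  set s : ℝ := (1 - ‖lam‖ ^ 2) ^ (α + 2) with hsdef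
  have d1 : DifferentiableOn ℂ (fun z => f z * extQ α lam z) (ball 0 1) :=
    hf.mul (extQ_diff α hα hlam)
  have d2 : DifferentiableOn ℂ (fun z => f z * ((s:ℂ) ^ 2 - s * recK α lam z)) (ball 0 1) :=
    hf.mul (((recK_diff α hlam).const_mul _).const_sub _)
  have b1 : ∀ z ∈ ball (0:ℂ) 1, ‖f z * extQ α lam z‖ ≤ M * B := by
    intro z hz
    rw [norm_mul]
    exact mul_le_mul (hM z hz) (hB z hz) (norm_nonneg _) hM0
  have b2 : ∀ z ∈ ball (0:ℂ) 1, ‖f z * ((s:ℂ) ^ 2 - s * recK α lam z)‖ ≤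
      M * (s ^ 2 + s * 2 ^ (α + 2)) := by
    intro z hz
    rw [norm_mul]
    refine mul_le_mul (hM z hz) ?_ (norm_nonneg _) hM0
    refine (norm_sub_le _ _).trans ?_
    rw [norm_mul, norm_pow, Complex.norm_of_nonneg hs.le]
    gcongr
    exact recK_le α hα hlam (by simpa using hz)
  have i1 := bdd_integrable α hα _ d1.continuousOn _ b1
  have i2 : IntegrableOn (fun z => f z * ((s:ℂ) ^ 2 - s * recK α lam z) *
      ((‖1 - z * (starRingEnd ℂ) lam‖ ^ (-(2 * (α + 2))) *
        ((α + 1) * (1 - ‖z‖ ^ 2) ^ α) : ℝ) : ℂ)) (ball 0 1) := by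
    have := bdd_integrable α hα (fun z => f z * ((s:ℂ) ^ 2 - s * recK α lam z) *
      ((‖1 - z * (starRingEnd ℂ) lam‖ ^ (-(2 * (α + 2))) : ℝ) : ℂ)) ?_
      (M * (s ^ 2 + s * 2 ^ (α + 2)) * (1 - ‖lam‖) ^ (-(2 * (α + 2)))) ?_
    · refine this.congr_fun ?_ measurableSet_ball
      intro z hz
      push_cast
      ring
    · apply d2.continuousOn.mul
      apply Complex.continuous_ofReal.comp_continuousOn
      apply ContinuousOn.rpow_const (by fun_prop)
      intro z hz
      exact Or.inl (norm_ne_zero_iff.2 (mob_den_ne hlam (by simpa using hz)))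
    · intro z hz
      have hz' : ‖z‖ < 1 := by simpa using hz
      rw [norm_mul, Complex.norm_of_nonneg (by positivity)]
      refine mul_le_mul (b2 z hz) ?_ (by positivity) (by positivity)
      apply Real.rpow_le_rpow_of_nonpos (by linarith) _ (by linarith)
      have := norm_sub_norm_le (1:ℂ) (z * (starRingEnd ℂ) lam)
      rw [norm_mul, RCLike.norm_conj, norm_one] at this
      nlinarith [norm_nonneg z, norm_nonneg lam]
  have m1 := mean_value α hα _ d1 _ b1
  have m2 := mobius_mean α hα lam hlam _ d2 _ b2
  have key : EqOn (fun z => f z * ((‖extQ α lam z‖ ^ 2 * ((α + 1) * (1 - ‖z‖ ^ 2) ^ α) : ℝ) : ℂ))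
      (fun z => f z * extQ α lam z * (((α + 1) * (1 - ‖z‖ ^ 2) ^ α : ℝ) : ℂ) +
        f z * ((s:ℂ) ^ 2 - s * recK α lam z) *
      ((‖1 - z * (starRingEnd ℂ) lam‖ ^ (-(2 * (α + 2))) *
        ((α + 1) * (1 - ‖z‖ ^ 2) ^ α) : ℝ) : ℂ)) (ball 0 1) := by
    intro z hz
    have hz' : ‖z‖ < 1 := by simpa using hz
    have hP := recK_ne α hα hlam hz'
    have hPc : (starRingEnd ℂ) (recK α lam z) ≠ 0 := by simpa using hP
    have e1 : ((‖1 - z * (starRingEnd ℂ) lam‖ ^ (-(2 * (α + 2))) : ℝ) : ℂ) =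
        1 / (recK α lam z * (starRingEnd ℂ) (recK α lam z)) := by
      rw [Complex.mul_conj, Complex.normSq_eq_norm_sq, recK_norm, Real.rpow_neg (norm_nonneg _),
        mul_comm 2 (α + 2), Real.rpow_mul (norm_nonneg _), Real.rpow_two]
      push_cast
      rw [one_div]
    have e2 : ((‖extQ α lam z‖ ^ 2 : ℝ) : ℂ) = extQ α lam z * (starRingEnd ℂ) (extQ α lam z) := by
      rw [Complex.mul_conj, Complex.normSq_eq_norm_sq]
    have e3 : extQ α lam z * (starRingEnd ℂ) (extQ α lam z) = extQ α lam z +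
        ((s:ℂ) ^ 2 - s * recK α lam z) * (1 / (recK α lam z * (starRingEnd ℂ) (recK α lam z))) := by
      rw [extQ, map_sub, map_div₀, Complex.conj_ofReal, map_one, ← hsdef]
      field_simp
      ring
    simp only [Complex.ofReal_mul (‖extQ α lam z‖ ^ 2),
      Complex.ofReal_mul (‖1 - z * (starRingEnd ℂ) lam‖ ^ (-(2 * (α + 2))))]
    rw [e1, e2, e3]
    ring
  rw [setIntegral_congr_fun measurableSet_ball key, integral_add i1 i2, m1, m2, recK_lam α hlam,
    extQ, recK_zero, ← hsdef]
  ring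

lemma core_real (α : ℝ) (hα : -1 < α) (lam : ℂ) (hlam : ‖lam‖ < 1) (u : ℂ → ℝ)
    (hu : InnerProductSpace.HarmonicOnNhd u (ball 0 1)) (M : ℝ)
    (hM : ∀ z ∈ ball (0:ℂ) 1, ‖u z‖ ≤ M) :
    ∫ z in ball (0:ℂ) 1, u z * (‖extQ α lam z‖ ^ 2 * ((α + 1) * (1 - ‖z‖ ^ 2) ^ α)) =
      Real.pi * (1 - (1 - ‖lam‖ ^ 2) ^ (α + 2)) * u 0 := by
  obtain ⟨B, hB0, hB⟩ := extQ_bdd α hα hlam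
  obtain ⟨F, hF, hFu⟩ := hu.exists_analyticOnNhd_ball_re_eq
  have hM0 : 0 ≤ M := (norm_nonneg _).trans (hM 0 (by simp))
  have hFd : DifferentiableOn ℂ F (ball 0 1) := hF.differentiableOn
  have hQc := (extQ_diff α hα hlam).continuousOn
  have huc : ContinuousOn u (ball 0 1) :=
    (Complex.continuous_re.comp_continuousOn hFd.continuousOn).congr (fun z hz => (hFu hz).symm)
  have hmap : ∀ r ∈ Ioo (0:ℝ) 1, MapsTo (fun z : ℂ => (r:ℂ) * z) (ball 0 1) (ball 0 1) := by
    intro r hr z hz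
    have hz' : ‖z‖ < 1 := by simpa using hz
    have : ‖(r:ℂ) * z‖ < 1 := by
      rw [norm_mul, Complex.norm_of_nonneg hr.1.le]
      nlinarith [norm_nonneg z, hr.1, hr.2]
    simpa using this
  have hWc : ∀ z ∈ ball (0:ℂ) 1, 0 ≤ (α + 1) * (1 - ‖z‖ ^ 2) ^ α := by
    intro z hz
    have hz' : ‖z‖ < 1 := by simpa using hz
    have h2 : 0 < 1 - ‖z‖ ^ 2 := by nlinarith [norm_nonneg z]
    have : 0 < α + 1 := by linarith
    positivity
  have hdil : ∀ r ∈ Ioo (0:ℝ) 1,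
      ∫ z in ball (0:ℂ) 1, u (r * z) * (‖extQ α lam z‖ ^ 2 * ((α + 1) * (1 - ‖z‖ ^ 2) ^ α)) =
      Real.pi * (1 - (1 - ‖lam‖ ^ 2) ^ (α + 2)) * u 0 := by
    intro r hr
    have hd : DifferentiableOn ℂ (fun z => F (r * z)) (ball 0 1) :=
      hFd.comp (by fun_prop) (hmap r hr)
    obtain ⟨N, hN⟩ := (isCompact_closedBall (0:ℂ) r).exists_bound_of_continuousOn
      (hFd.continuousOn.mono (closedBall_subset_ball hr.2))
    have hN' : ∀ z ∈ ball (0:ℂ) 1, ‖F (r * z)‖ ≤ N := by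
      intro z hz
      apply hN
      have hz' : ‖z‖ < 1 := by simpa using hz
      rw [mem_closedBall_zero_iff, norm_mul, Complex.norm_of_nonneg hr.1.le]
      nlinarith [norm_nonneg z, hr.1, hr.2]
    have hN0 : 0 ≤ N := (norm_nonneg _).trans (hN' 0 (by simp))
    have h := core_analytic α hα lam hlam _ hd N hN'
    have hint : IntegrableOn (fun z : ℂ => F (r * z) *
        ((‖extQ α lam z‖ ^ 2 * ((α + 1) * (1 - ‖z‖ ^ 2) ^ α) : ℝ) : ℂ)) (ball 0 1) := by
      have := bdd_integrable α hα (fun z => F (r * z) * ((‖extQ α lam z‖ ^ 2 : ℝ) : ℂ))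
        (hd.continuousOn.mul (Complex.continuous_ofReal.comp_continuousOn (hQc.norm.pow 2)))
        (N * B ^ 2) ?_
      · refine this.congr_fun ?_ measurableSet_ball
        intro z hz
        push_cast
        ring
      · intro z hz
        rw [norm_mul, Complex.norm_of_nonneg (by positivity)]
        have := hB z hz
        exact mul_le_mul (hN' z hz) (by gcongr) (by positivity) hN0
    have h' := congrArg Complex.reCLM h
    rw [← ContinuousLinearMap.integral_comp_comm _ hint] at h'
    have e : EqOn (fun z : ℂ => Complex.reCLM (F (r * z) *
        ((‖extQ α lam z‖ ^ 2 * ((α + 1) * (1 - ‖z‖ ^ 2) ^ α) : ℝ) : ℂ)))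
        (fun z => u (r * z) * (‖extQ α lam z‖ ^ 2 * ((α + 1) * (1 - ‖z‖ ^ 2) ^ α))) (ball 0 1) := by
      intro z hz
      simp only [Complex.reCLM_apply, Complex.re_mul_ofReal]
      rw [← hFu (hmap r hr hz)]
    rw [setIntegral_congr_fun measurableSet_ball e] at h'
    rw [h', mul_zero, Complex.reCLM_apply, ← hFu (by simp), ← Complex.ofReal_one,
      ← Complex.ofReal_sub, ← Complex.ofReal_mul, Complex.re_ofReal_mul]
  have hlim : Tendsto (fun r : ℝ => ∫ z in ball (0:ℂ) 1,
      u (r * z) * (‖extQ α lam z‖ ^ 2 * ((α + 1) * (1 - ‖z‖ ^ 2) ^ α))) (𝓝[<] 1)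
      (𝓝 (∫ z in ball (0:ℂ) 1, u z * (‖extQ α lam z‖ ^ 2 * ((α + 1) * (1 - ‖z‖ ^ 2) ^ α)))) := by
    have hev : ∀ᶠ r : ℝ in 𝓝[<] 1, r ∈ Ioo (0:ℝ) 1 := Ioo_mem_nhdsLT one_pos
    apply tendsto_integral_filter_of_dominated_convergence
      (fun z => M * B ^ 2 * ((α + 1) * (1 - ‖z‖ ^ 2) ^ α))
    · filter_upwards [hev] with r hr
      exact ((huc.comp (by fun_prop) (hmap r hr)).aestronglyMeasurable measurableSet_ball).mul
        (((hQc.norm.pow 2).aestronglyMeasurable measurableSet_ball).mul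
          (weight_integrable α hα).aestronglyMeasurable)
    · filter_upwards [hev] with r hr
      refine (ae_restrict_iff' measurableSet_ball).2 (Eventually.of_forall fun z hz => ?_)
      rw [← mul_assoc, norm_mul, norm_mul, Real.norm_of_nonneg (hWc z hz), norm_pow, norm_norm]
      have := hB z hz
      exact mul_le_mul_of_nonneg_right (mul_le_mul (hM _ (hmap r hr hz)) (by gcongr)
        (by positivity) hM0) (hWc z hz)
    · exact (weight_integrable α hα).const_mul _
    · refine (ae_restrict_iff' measurableSet_ball).2 (Eventually.of_forall fun z hz => ?_)
      apply Tendsto.mul_const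
      have h1 : ContinuousAt u z := huc.continuousAt (isOpen_ball.mem_nhds hz)
      have h2 : Tendsto (fun r : ℝ => (r:ℂ) * z) (𝓝[<] 1) (𝓝 z) := by
        have : Continuous (fun r : ℝ => (r:ℂ) * z) := by fun_prop
        have := this.tendsto 1
        simp only [Complex.ofReal_one, one_mul] at this
        exact this.mono_left nhdsWithin_le_nhds
      exact h1.tendsto.comp h2
  refine tendsto_nhds_unique hlim ?_
  refine (tendsto_congr' ?_).2 tendsto_const_nhds
  filter_upwards [(Ioo_mem_nhdsLT one_pos : Ioo (0:ℝ) 1 ∈ 𝓝[<] 1)] with r hr using hdil r hr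

lemma harmonic_of_lapC (h : ℂ → ℂ) (hc : ContDiffOn ℝ 2 h (ball 0 1))
    (hl : ∀ z ∈ ball (0:ℂ) 1, lapC h z = 0) :
    InnerProductSpace.HarmonicOnNhd h (ball 0 1) := by
  intro z hz
  refine ⟨hc.contDiffAt (isOpen_ball.mem_nhds hz), ?_⟩
  filter_upwards [isOpen_ball.mem_nhds hz] with w hw
  have hd : DifferentiableAt ℝ (fderiv ℝ h) w :=
    ((hc.contDiffAt (isOpen_ball.mem_nhds hw)).fderiv_right (m := 1) (by norm_num)).differentiableAt
      (by norm_num)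
  have := hl w hw
  rw [lapC, fderiv_clm_apply hd (by fun_prop), fderiv_clm_apply hd (by fun_prop)] at this
  rw [InnerProductSpace.laplacian_eq_iteratedFDeriv_complexPlane]
  simp [iteratedFDeriv_two_apply] at this ⊢
  exact this

/-- the extremal function φ_{λ,α} has the mean value property:
∫_𝔻 h |φ_{λ,α}|² (α+1)(1-|z|²)^α dΣ = h(0) for every bounded harmonic h. -/
theorem statement4 (α : ℝ) (hα : -1 < α) (lam : ℂ)
    (hlam : lam ∈ unitDisk) (hlam0 : lam ≠ 0) (φ : ℂ → ℂ)
    (hφ : ∀ z : ℂ, φ z =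
      (((1 - (1 - ‖lam‖ ^ 2) ^ (α + 2)) ^ (-(1 / 2) : ℝ) : ℝ) : ℂ) *
        (1 - (((1 - ‖lam‖ ^ 2) ^ (α + 2) : ℝ) : ℂ) /
          (1 - z * (starRingEnd ℂ) lam) ^ ((α : ℂ) + 2))) :
    ∀ h : ℂ → ℂ, BoundedHarmonicC h →
      ∫ z in unitDisk,
          h z * ((‖φ z‖ ^ 2 * ((α + 1) * (1 - ‖z‖ ^ 2) ^ α) : ℝ) : ℂ) ∂dSigma
        = h 0 := by
  intro h hh
  obtain ⟨hc, hl, M, hM⟩ := hh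
  have hlam1 : ‖lam‖ < 1 := by simpa [unitDisk] using hlam
  have hharm := harmonic_of_lapC h hc hl
  have hre := core_real α hα lam hlam1 _ (hharm.comp_CLM Complex.reCLM) M
    (fun z hz => (Complex.abs_re_le_norm _).trans (hM z hz))
  have him := core_real α hα lam hlam1 _ (hharm.comp_CLM Complex.imCLM) M
    (fun z hz => (Complex.abs_im_le_norm _).trans (hM z hz))
  obtain ⟨B, hB0, hB⟩ := extQ_bdd α hα hlam1
  have hM0 : 0 ≤ M := (norm_nonneg _).trans (hM 0 (by simp [unitDisk]))
  have hl0 : 0 < ‖lam‖ := norm_pos_iff.2 hlam0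
  have hs : (1 - ‖lam‖ ^ 2) ^ (α + 2) < 1 :=
    Real.rpow_lt_one (by nlinarith) (by nlinarith) (by linarith)
  have hint : IntegrableOn (fun z : ℂ => h z *
      ((‖extQ α lam z‖ ^ 2 * ((α + 1) * (1 - ‖z‖ ^ 2) ^ α) : ℝ) : ℂ)) (ball 0 1) := by
    have := bdd_integrable α hα (fun z => h z * ((‖extQ α lam z‖ ^ 2 : ℝ) : ℂ))
      (ContinuousOn.mul hc.continuousOn (Complex.continuous_ofReal.comp_continuousOn
        ((extQ_diff α hα hlam1).continuousOn.norm.pow 2)))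
      (M * B ^ 2) ?_
    · refine this.congr_fun ?_ measurableSet_ball
      intro z hz
      push_cast
      ring
    · intro z hz
      rw [norm_mul, Complex.norm_of_nonneg (by positivity)]
      have := hB z hz
      exact mul_le_mul (hM z hz) (by gcongr) (by positivity) hM0
  have hcx : ∫ z in ball (0:ℂ) 1, h z *
      ((‖extQ α lam z‖ ^ 2 * ((α + 1) * (1 - ‖z‖ ^ 2) ^ α) : ℝ) : ℂ) =
      ((Real.pi * (1 - (1 - ‖lam‖ ^ 2) ^ (α + 2)) : ℝ) : ℂ) * h 0 := by
    apply Complex.ext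
    · rw [← Complex.reCLM_apply, ← ContinuousLinearMap.integral_comp_comm _ hint]
      simpa only [Complex.reCLM_apply, Complex.re_mul_ofReal, Complex.re_ofReal_mul,
        Function.comp_apply] using hre
    · rw [← Complex.imCLM_apply, ← ContinuousLinearMap.integral_comp_comm _ hint]
      simpa only [Complex.imCLM_apply, Complex.im_mul_ofReal, Complex.im_ofReal_mul,
        Function.comp_apply] using him
  have hphi : ∀ z : ℂ, h z * ((‖φ z‖ ^ 2 * ((α + 1) * (1 - ‖z‖ ^ 2) ^ α) : ℝ) : ℂ) =
      ((1 / (1 - (1 - ‖lam‖ ^ 2) ^ (α + 2)) : ℝ) : ℂ) * (h z *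
      ((‖extQ α lam z‖ ^ 2 * ((α + 1) * (1 - ‖z‖ ^ 2) ^ α) : ℝ) : ℂ)) := by
    intro z
    have hp : 0 < 1 - (1 - ‖lam‖ ^ 2) ^ (α + 2) := by linarith
    have e : ‖φ z‖ ^ 2 = 1 / (1 - (1 - ‖lam‖ ^ 2) ^ (α + 2)) * ‖extQ α lam z‖ ^ 2 := by
      rw [hφ, norm_mul, Complex.norm_of_nonneg (by positivity), mul_pow]
      congr 1
      rw [← Real.rpow_mul_natCast hp.le]
      norm_num
      rw [Real.rpow_neg_one]
    rw [e]
    push_cast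
    ring
  simp_rw [hphi]
  have hp : ((1 - (1 - ‖lam‖ ^ 2) ^ (α + 2) : ℝ) : ℂ) ≠ 0 := by
    exact_mod_cast (by linarith : (0:ℝ) < 1 - (1 - ‖lam‖ ^ 2) ^ (α + 2)).ne'
  have hpi : (Real.pi : ℂ) ≠ 0 := by exact_mod_cast Real.pi_ne_zero
  rw [integral_const_mul, dSigma, Measure.restrict_smul, integral_smul_measure, unitDisk, hcx,
    ENNReal.toReal_ofReal (by positivity), Complex.real_smul, Complex.ofReal_mul,
    Complex.ofReal_div, Complex.ofReal_div, Complex.ofReal_one]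
  field_simp

end
end

section
/- Let Γ̃₁(z,w) = (|z−w|² − (1/4)|z²−w²|²)·log|(z−w)/(1−z·conj(w))|² + (1/8)(1−|z|²)(1−|w|²)·[7 − |z|² − |w|² − |zw|² − 4·Re(z·conj(w)) − 2(1−|z|²)(1−|w|²)(1−|zw|²)/|1−z·conj(w)|²]. Then for every fixed w ∈ D and every z ∈ D with z ≠ w, Δ_z Γ̃₁(z,w) = (1−|z|²)·[G(z,w) + H₁(z,w)], where G(z,w) = log|(z−w)/(1−z·conj(w))|² and H₁(z,w) = (1−|w|²)·[ (1/2)(3−|w|²)·(1−|zw|²)/|1−z·conj(w)|² + (1−|w|²)·Re( z·conj(w)/(1−z·conj(w))² ) ]. -/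
open Complex MeasureTheory Metric Set

noncomputable section

/-- The explicit candidate Γ̃₁ for the Green function of the weighted biharmonic
operator Δ(1-|z|²)⁻¹Δ on the unit disk. -/
def Gamma1 (z w : ℂ) : ℝ :=
  (‖z - w‖ ^ 2 - (1 / 4) * ‖z ^ 2 - w ^ 2‖ ^ 2) *
      Real.log (‖(z - w) / (1 - z * (starRingEnd ℂ) w)‖ ^ 2)
    + (1 / 8) * (1 - ‖z‖ ^ 2) * (1 - ‖w‖ ^ 2) *
      (7 - ‖z‖ ^ 2 - ‖w‖ ^ 2 - ‖z * w‖ ^ 2 - 4 * (z * (starRingEnd ℂ) w).re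
        - 2 * (1 - ‖z‖ ^ 2) * (1 - ‖w‖ ^ 2) * (1 - ‖z * w‖ ^ 2) /
            ‖1 - z * (starRingEnd ℂ) w‖ ^ 2)

/-- The Green function for the normalized Laplacian Δ on the unit disk. -/
def GreenG (z w : ℂ) : ℝ :=
  Real.log (‖(z - w) / (1 - z * (starRingEnd ℂ) w)‖ ^ 2)

/-- The harmonic (in z) function H₁(z,w). -/
def H1 (z w : ℂ) : ℝ :=
  (1 - ‖w‖ ^ 2) *
    ((1 / 2) * (3 - ‖w‖ ^ 2) * (1 - ‖z * w‖ ^ 2) / ‖1 - z * (starRingEnd ℂ) w‖ ^ 2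
      + (1 - ‖w‖ ^ 2) *
        (z * (starRingEnd ℂ) w / (1 - z * (starRingEnd ℂ) w) ^ 2).re)

/-- Real differentiability with Wirtinger derivatives `p = ∂u/∂z`, `q = ∂u/∂z̄`. -/
def HasWirt (u : ℂ → ℂ) (p q z : ℂ) : Prop :=
  HasFDerivAt u (p • (ContinuousLinearMap.id ℝ ℂ) + q • (Complex.conjCLE : ℂ →L[ℝ] ℂ)) z

theorem HasWirt.const (k z : ℂ) : HasWirt (fun _ => k) 0 0 z := by
  refine HasFDerivAt.congr_fderiv (hasFDerivAt_const k z) (ContinuousLinearMap.ext fun x => ?_)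
  simp

theorem HasWirt.id (z : ℂ) : HasWirt (fun z => z) 1 0 z := by
  refine HasFDerivAt.congr_fderiv (hasFDerivAt_id (𝕜 := ℝ) z)
    (ContinuousLinearMap.ext fun x => ?_)
  simp

theorem HasWirt.conj (z : ℂ) : HasWirt (fun z => (starRingEnd ℂ) z) 0 1 z := by
  refine HasFDerivAt.congr_fderiv ((Complex.conjCLE : ℂ →L[ℝ] ℂ).hasFDerivAt (x := z))
    (ContinuousLinearMap.ext fun x => ?_)
  simp

theorem HasWirt.add {u v : ℂ → ℂ} {p q p' q' z : ℂ} (h : HasWirt u p q z)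
    (h' : HasWirt v p' q' z) : HasWirt (fun z => u z + v z) (p + p') (q + q') z := by
  refine HasFDerivAt.congr_fderiv (HasFDerivAt.add h h') (ContinuousLinearMap.ext fun x => ?_)
  simp
  ring

theorem HasWirt.sub {u v : ℂ → ℂ} {p q p' q' z : ℂ} (h : HasWirt u p q z)
    (h' : HasWirt v p' q' z) : HasWirt (fun z => u z - v z) (p - p') (q - q') z := by
  refine HasFDerivAt.congr_fderiv (HasFDerivAt.sub h h') (ContinuousLinearMap.ext fun x => ?_)
  simp
  ring

theorem HasWirt.mul {u v : ℂ → ℂ} {p q p' q' z : ℂ} (h : HasWirt u p q z)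
    (h' : HasWirt v p' q' z) :
    HasWirt (fun z => u z * v z) (u z * p' + v z * p) (u z * q' + v z * q) z := by
  refine HasFDerivAt.congr_fderiv (HasFDerivAt.mul h h') (ContinuousLinearMap.ext fun x => ?_)
  simp
  ring

theorem HasWirt.inv {u : ℂ → ℂ} {p q z : ℂ} (h : HasWirt u p q z) (hz : u z ≠ 0) :
    HasWirt (fun z => (u z)⁻¹) (-p * (u z)⁻¹ ^ 2) (-q * (u z)⁻¹ ^ 2) z := by
  have h2 := ((hasDerivAt_inv hz).hasFDerivAt.restrictScalars ℝ).comp z h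
  refine HasFDerivAt.congr_fderiv h2 (ContinuousLinearMap.ext fun x => ?_)
  simp
  ring

theorem HasWirt.congr {u v : ℂ → ℂ} {p q z : ℂ} (h : HasWirt u p q z) (e : ∀ y, v y = u y) :
    HasWirt v p q z := by
  rwa [show v = u from funext e]

theorem HasWirt.real {s : ℂ → ℝ} {p q z : ℂ} (h : HasWirt (fun z => (s z : ℂ)) p q z) :
    HasFDerivAt s (Complex.reCLM.comp
      (p • (ContinuousLinearMap.id ℝ ℂ) + q • (Complex.conjCLE : ℂ →L[ℝ] ℂ))) z := by
  have h2 := (Complex.reCLM.hasFDerivAt (x := (s z : ℂ))).comp z h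
  exact h2

theorem HasWirt.log {s : ℂ → ℝ} {p q z : ℂ} (h : HasWirt (fun z => (s z : ℂ)) p q z)
    (hz : s z ≠ 0) :
    HasWirt (fun z => (Real.log (s z) : ℂ)) (p / s z) (q / s z) z := by
  have h1 := h.real
  have h2 := (Complex.ofRealCLM.hasFDerivAt (x := s z)).comp z h1
  have h3 := HasFDerivAt.unique h h2
  have h4 := (Complex.ofRealCLM.hasFDerivAt (x := Real.log (s z))).comp z (h1.log hz)
  refine HasFDerivAt.congr_fderiv h4 (ContinuousLinearMap.ext fun x => ?_)
  have h5 : p * x + q * (starRingEnd ℂ) x = ((p * x + q * (starRingEnd ℂ) x).re : ℂ) :=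
    congrArg (fun T : ℂ →L[ℝ] ℂ => T x) h3
  have h6 : (((s z)⁻¹ * (p * x + q * (starRingEnd ℂ) x).re : ℝ) : ℂ) =
      p / s z * x + q / s z * (starRingEnd ℂ) x := by
    rw [Complex.ofReal_mul, ← h5, Complex.ofReal_inv]
    ring
  exact h6

open Filter Topology in
theorem lapR_of_wirt {u : ℂ → ℝ} {p q : ℂ → ℂ} {p1 p2 q1 q2 z : ℂ}
    (h : ∀ᶠ y in 𝓝 z, HasWirt (fun z => (u z : ℂ)) (p y) (q y) y)
    (hp : HasWirt p p1 p2 z) (hq : HasWirt q q1 q2 z) :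
    lapR u z = ((p2 + q1) / 2).re := by
  have e1 : (fun w => fderiv ℝ u w 1) =ᶠ[𝓝 z] fun y => (p y + q y).re := by
    filter_upwards [h] with y hy
    rw [hy.real.fderiv]
    simp
  have e2 : (fun w => fderiv ℝ u w Complex.I) =ᶠ[𝓝 z]
      fun y => ((p y - q y) * Complex.I).re := by
    filter_upwards [h] with y hy
    rw [hy.real.fderiv]
    simp
    ring
  have d1 := (Complex.reCLM.hasFDerivAt (x := p z + q z)).comp z (hp.add hq)
  have d2 := (Complex.reCLM.hasFDerivAt (x := (p z - q z) * Complex.I)).comp z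
    ((hp.sub hq).mul (HasWirt.const Complex.I z))
  unfold lapR
  rw [e1.fderiv_eq, e2.fderiv_eq]
  have f1 : fderiv ℝ (fun y => (p y + q y).re) z = _ := d1.fderiv
  have f2 : fderiv ℝ (fun y => ((p y - q y) * Complex.I).re) z = _ := d2.fderiv
  rw [f1, f2]
  simp
  ring

theorem one_sub_ne {w z : ℂ} (hw : w ∈ unitDisk) (hz : z ∈ unitDisk) :
    1 - z * (starRingEnd ℂ) w ≠ 0 := by
  intro h
  have h1 : z * (starRingEnd ℂ) w = 1 := (sub_eq_zero.mp h).symm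
  have h2 := congrArg norm h1
  simp [unitDisk] at hw hz h2
  nlinarith [norm_nonneg z, norm_nonneg w]

theorem sq_norm_cast (x : ℂ) : ((‖x‖ : ℂ)) ^ 2 = x * (starRingEnd ℂ) x := by
  rw [Complex.mul_conj']

theorem re_cast (x : ℂ) : ((x.re : ℝ) : ℂ) = (x + (starRingEnd ℂ) x) / 2 := by
  rw [Complex.add_conj]; simp

/-- Wirtinger derivatives of the Green function. -/
theorem wirt_green {w z : ℂ} (h0 : z - w ≠ 0) (h1 : 1 - z * (starRingEnd ℂ) w ≠ 0) :
    HasWirt (fun z => (GreenG z w : ℂ))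
      ((1 - w * (starRingEnd ℂ) w) / ((z - w) * (1 - z * (starRingEnd ℂ) w)))
      ((1 - w * (starRingEnd ℂ) w) /
        (((starRingEnd ℂ) z - (starRingEnd ℂ) w) * (1 - (starRingEnd ℂ) z * w))) z := by
  have c0 : (starRingEnd ℂ) z - (starRingEnd ℂ) w ≠ 0 := by
    rw [← map_sub]; exact (map_ne_zero (starRingEnd ℂ)).mpr h0
  have c1 : 1 - (starRingEnd ℂ) z * w ≠ 0 := by
    have := (map_ne_zero (starRingEnd ℂ)).mpr h1
    simpa using this
  have e : ∀ z : ℂ, ((‖(z - w) / (1 - z * (starRingEnd ℂ) w)‖ ^ 2 : ℝ) : ℂ) =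
      ((z - w) * ((starRingEnd ℂ) z - (starRingEnd ℂ) w)) *
        ((1 - z * (starRingEnd ℂ) w) * (1 - (starRingEnd ℂ) z * w))⁻¹ := by
    intro y
    push_cast
    rw [sq_norm_cast]
    simp [div_eq_mul_inv]
    ring
  have hs := (((HasWirt.id z).sub (.const w z)).mul
    ((HasWirt.conj z).sub (.const ((starRingEnd ℂ) w) z))).mul
      ((((HasWirt.const 1 z).sub ((HasWirt.id z).mul (.const ((starRingEnd ℂ) w) z))).mul
        ((HasWirt.const 1 z).sub ((HasWirt.conj z).mul (.const w z)))).inv (mul_ne_zero h1 c1))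
  have hs := HasWirt.congr hs e
  have hl := hs.log (pow_ne_zero 2 (norm_ne_zero_iff.mpr (div_ne_zero h0 h1)))
  rw [e z] at hl
  unfold GreenG
  clear hs e
  have c1' : 1 - w * (starRingEnd ℂ) z ≠ 0 := by rwa [mul_comm]
  have h1' : 1 - (starRingEnd ℂ) w * z ≠ 0 := by rwa [mul_comm]
  convert hl using 1 <;>
  · clear hl
    generalize (starRingEnd ℂ) z = c at *
    generalize (starRingEnd ℂ) w = v at *
    field_simp
    ring

/-- `∂Γ/∂z` written with independent letters `z, c = z̄, w, v = w̄, L = G`. -/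
def pz (z c w v L : ℂ) : ℂ :=
  ((c - v) - (1 / 2) * z * (c * c - v * v)) * L
    + (c - v) * (1 - (1 / 4) * ((z + w) * (c + v))) * (1 - w * v) * (1 - z * v)⁻¹
    + (1 / 8) * (1 - w * v) * (-c * (7 - z * c - w * v - z * c * w * v - 2 * (z * v + c * w))
      + (1 - z * c) * (-c - c * w * v - 2 * v))
    - (1 / 4) * (1 - w * v) * (1 - w * v) * (1 - c * w)⁻¹ *
      ((-2 * c * (1 - z * c) * (1 - z * c * w * v) - c * w * v * (1 - z * c) * (1 - z * c))
        * (1 - z * v)⁻¹ +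
       (1 - z * c) * (1 - z * c) * (1 - z * c * w * v) * v * ((1 - z * v)⁻¹ * (1 - z * v)⁻¹))

theorem gamma_cast (z w : ℂ) : (Gamma1 z w : ℂ) =
    ((z - w) * ((starRingEnd ℂ) z - (starRingEnd ℂ) w)
      - (1 / 4) * ((z * z - w * w) * ((starRingEnd ℂ) z * (starRingEnd ℂ) z
        - (starRingEnd ℂ) w * (starRingEnd ℂ) w))) * (GreenG z w : ℂ)
    + ((1 / 8) * (1 - w * (starRingEnd ℂ) w)) * ((1 - z * (starRingEnd ℂ) z) *
      (7 - z * (starRingEnd ℂ) z - w * (starRingEnd ℂ) w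
        - z * (starRingEnd ℂ) z * (w * (starRingEnd ℂ) w)
        - 2 * (z * (starRingEnd ℂ) w + (starRingEnd ℂ) z * w)))
    - ((1 / 4) * (1 - w * (starRingEnd ℂ) w) * (1 - w * (starRingEnd ℂ) w)) *
      (((1 - z * (starRingEnd ℂ) z) * (1 - z * (starRingEnd ℂ) z) *
        (1 - z * (starRingEnd ℂ) z * (w * (starRingEnd ℂ) w))) *
        ((1 - z * (starRingEnd ℂ) w)⁻¹ * (1 - (starRingEnd ℂ) z * w)⁻¹)) := by
  unfold Gamma1 GreenG
  push_cast
  simp only [sq_norm_cast, re_cast]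
  simp only [map_sub, map_mul, map_one, map_pow, Complex.conj_conj, div_eq_mul_inv, mul_inv]
  ring

theorem wirt_gamma {w z : ℂ} (h0 : z - w ≠ 0) (h1 : 1 - z * (starRingEnd ℂ) w ≠ 0) :
    HasWirt (fun z => (Gamma1 z w : ℂ))
      (pz z ((starRingEnd ℂ) z) w ((starRingEnd ℂ) w) (GreenG z w))
      (pz ((starRingEnd ℂ) z) z ((starRingEnd ℂ) w) w (GreenG z w)) z := by
  have c0 : (starRingEnd ℂ) z - (starRingEnd ℂ) w ≠ 0 := by
    rw [← map_sub]; exact (map_ne_zero (starRingEnd ℂ)).mpr h0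
  have c1 : 1 - (starRingEnd ℂ) z * w ≠ 0 := by
    have := (map_ne_zero (starRingEnd ℂ)).mpr h1
    simpa using this
  have hG := wirt_green h0 h1
  have I := HasWirt.id z
  have C := HasWirt.conj z
  have K := fun k => HasWirt.const k z
  have A := (K 1).sub (I.mul C)
  have E1 := ((K 1).sub (I.mul (K ((starRingEnd ℂ) w)))).inv h1
  have E2 := ((K 1).sub (C.mul (K w))).inv c1
  have T1 := ((((I.sub (K w)).mul (C.sub (K ((starRingEnd ℂ) w)))).sub ((K (1 / 4)).mul
    (((I.mul I).sub (K (w * w))).mul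
      ((C.mul C).sub (K ((starRingEnd ℂ) w * (starRingEnd ℂ) w)))))).mul hG)
  have T2 := (K ((1 / 8) * (1 - w * (starRingEnd ℂ) w))).mul (A.mul
    (((((K 7).sub (I.mul C)).sub (K (w * (starRingEnd ℂ) w))).sub
      ((I.mul C).mul (K (w * (starRingEnd ℂ) w)))).sub
      ((K 2).mul ((I.mul (K ((starRingEnd ℂ) w))).add (C.mul (K w))))))
  have T3 := (K ((1 / 4) * (1 - w * (starRingEnd ℂ) w) * (1 - w * (starRingEnd ℂ) w))).mul
    (((A.mul A).mul ((K 1).sub ((I.mul C).mul (K (w * (starRingEnd ℂ) w))))).mul (E1.mul E2))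
  have T := (T1.add T2).sub T3
  simp only [gamma_cast]
  clear T1 T2 T3 hG A E1 E2 I C K
  convert T using 1
  · clear T
    generalize (starRingEnd ℂ) z = c at *
    generalize (starRingEnd ℂ) w = v at *
    generalize (GreenG z w : ℂ) = L at *
    unfold pz
    field_simp
    ring
  · clear T
    generalize (starRingEnd ℂ) z = c at *
    generalize (starRingEnd ℂ) w = v at *
    generalize (GreenG z w : ℂ) = L at *
    have c1' : 1 - w * c ≠ 0 := by rwa [mul_comm]
    unfold pz
    field_simp
    ring

/-- Directional derivative of `pz`, in terms of those of `z, c, L` and of the inverses. -/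
def dpz (z c w v L a b l e f : ℂ) : ℂ :=
  ((c - v) - z * (c * c - v * v) / 2) * l + L * (b - z * c * b - (c * c - v * v) * a / 2)
  + (1 - w * v) * ((c - v) * (1 - (z + w) * (c + v) / 4) * e
    + (1 - z * v)⁻¹ * (b * (1 - (z + w) * (c + v) / 4)
      - (c - v) * (a * (c + v) + b * (z + w)) / 4))
  + (1 - w * v) / 8 * (-b * (7 - z * c - w * v - z * c * w * v - 2 * (z * v + c * w))
      + c * ((a * c + b * z) * (1 + w * v) + 2 * (a * v + b * w))
      + (a * c + b * z) * (c + c * w * v + 2 * v) - (1 - z * c) * (b + b * w * v))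
  - (1 - w * v) ^ 2 / 4 * (f *
      ((-2 * c * (1 - z * c) * (1 - z * c * w * v) - c * w * v * (1 - z * c) ^ 2) * (1 - z * v)⁻¹
        + (1 - z * c) ^ 2 * (1 - z * c * w * v) * v * ((1 - z * v)⁻¹) ^ 2)
    + (1 - c * w)⁻¹ *
      ((-2 * b * (1 - z * c) * (1 - z * c * w * v)
          + 2 * c * (a * c + b * z) * (1 - z * c * w * v)
          + 4 * c * (1 - z * c) * (a * c + b * z) * w * v - b * w * v * (1 - z * c) ^ 2)
          * (1 - z * v)⁻¹
        + (-2 * c * (1 - z * c) * (1 - z * c * w * v) - c * w * v * (1 - z * c) ^ 2) * e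
        + v * (-2 * (1 - z * c) * (a * c + b * z) * (1 - z * c * w * v)
          - (1 - z * c) ^ 2 * (a * c + b * z) * w * v) * ((1 - z * v)⁻¹) ^ 2
        + 2 * (1 - z * c) ^ 2 * (1 - z * c * w * v) * v * (1 - z * v)⁻¹ * e))

theorem wirt_pz {Z C L : ℂ → ℂ} {w v z a1 a2 b1 b2 l1 l2 e1 e2 f1 f2 : ℂ}
    (hZ : HasWirt Z a1 a2 z) (hC : HasWirt C b1 b2 z) (hL : HasWirt L l1 l2 z)
    (hE : HasWirt (fun z => (1 - Z z * v)⁻¹) e1 e2 z)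
    (hF : HasWirt (fun z => (1 - C z * w)⁻¹) f1 f2 z) :
    HasWirt (fun z => pz (Z z) (C z) w v (L z)) (dpz (Z z) (C z) w v (L z) a1 b1 l1 e1 f1)
      (dpz (Z z) (C z) w v (L z) a2 b2 l2 e2 f2) z := by
  have K := fun k => HasWirt.const k z
  have A := (K 1).sub (hZ.mul hC)
  have M := (K 1).sub (((hZ.mul hC).mul (K w)).mul (K v))
  have T1 := ((hC.sub (K v)).sub (((K (1 / 2)).mul hZ).mul ((hC.mul hC).sub (K (v * v))))).mul hL
  have T2 := ((((hC.sub (K v)).mul ((K 1).sub ((K (1 / 4)).mul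
    ((hZ.add (K w)).mul (hC.add (K v)))))).mul (K (1 - w * v))).mul hE)
  have N := (K 0).sub hC
  have S := ((((K 7).sub (hZ.mul hC)).sub (K (w * v))).sub
    (((hZ.mul hC).mul (K w)).mul (K v))).sub ((K 2).mul ((hZ.mul (K v)).add (hC.mul (K w))))
  have T3 := (K ((1 / 8) * (1 - w * v))).mul ((N.mul S).add
    (A.mul ((N.sub ((hC.mul (K w)).mul (K v))).sub (K (2 * v)))))
  have T4 := ((K ((1 / 4) * (1 - w * v) * (1 - w * v))).mul hF).mul
    ((((((((K (-2)).mul hC).mul A).mul M).sub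
      ((((hC.mul (K w)).mul (K v)).mul A).mul A)).mul hE)).add
      ((((A.mul A).mul M).mul (K v)).mul (hE.mul hE)))
  have T := HasWirt.congr (((T1.add T2).add T3).sub T4)
    (v := fun z => pz (Z z) (C z) w v (L z)) (by intro y; unfold pz; ring)
  clear T1 T2 T3 T4 N S A M K
  convert T using 1 <;>
  · clear T
    unfold dpz
    ring

set_option maxRecDepth 10000 in
set_option maxHeartbeats 1000000 in
theorem key_identity {z c w v L : ℂ} (c0 : c - v ≠ 0) (h1 : 1 - z * v ≠ 0)
    (c1 : 1 - c * w ≠ 0) :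
    dpz z c w v L 0 1 ((1 - w * v) / ((c - v) * (1 - c * w))) 0 (w * ((1 - c * w)⁻¹) ^ 2) =
      (1 - z * c) * (L + (1 - w * v) * ((1 / 2) * (3 - w * v) * (1 - z * w * (c * v))
        / ((1 - z * v) * (1 - c * w)) + (1 - w * v) *
          ((z * v / (1 - z * v) ^ 2 + c * w / (1 - c * w) ^ 2) / 2))) := by
  have hl : ((c - v) - z * (c * c - v * v) / 2) * ((1 - w * v) / ((c - v) * (1 - c * w)))
      = (1 - z * (c + v) / 2) * (1 - w * v) * (1 - c * w)⁻¹ := by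
    have c1' : 1 - w * c ≠ 0 := by rwa [mul_comm]
    field_simp
    ring
  unfold dpz
  rw [hl]
  have hE : z * v = 1 - (1 - z * v) := by ring
  obtain ⟨E, hE⟩ : ∃ E, E = (1 - z * v)⁻¹ := ⟨_, rfl⟩
  obtain ⟨F, hF⟩ : ∃ F, F = (1 - c * w)⁻¹ := ⟨_, rfl⟩
  have hE1 : E * (1 - z * v) = 1 := by rw [hE]; exact inv_mul_cancel₀ h1
  have hF1 : F * (1 - c * w) = 1 := by rw [hF]; exact inv_mul_cancel₀ c1
  have e1 : ∀ x : ℂ, x / (1 - z * v) ^ 2 = x * E ^ 2 := by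
    intro x; rw [hE, div_eq_mul_inv, inv_pow]
  have e2 : ∀ x : ℂ, x / (1 - c * w) ^ 2 = x * F ^ 2 := by
    intro x; rw [hF, div_eq_mul_inv, inv_pow]
  have e3 : ∀ x : ℂ, x / ((1 - z * v) * (1 - c * w)) = x * (E * F) := by
    intro x; rw [hE, hF, div_eq_mul_inv, mul_inv]
  rw [e1, e2, e3, ← hE, ← hF]
  have hD : (1 - z * v) ^ 2 * (1 - c * w) ^ 2 ≠ 0 := by positivity
  apply mul_left_cancel₀ hD
  rw [← sub_eq_zero]
  have hEE : E = 1 / (1 - z * v) := by rw [hE, one_div]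
  have hFF : F = 1 / (1 - c * w) := by rw [hF, one_div]
  obtain ⟨d, hd⟩ : ∃ d, d = 1 - z * v := ⟨_, rfl⟩
  obtain ⟨g, hg⟩ : ∃ g, g = 1 - c * w := ⟨_, rfl⟩
  rw [← hd] at hEE h1
  rw [← hg] at hFF c1
  rw [← hd, ← hg, hEE, hFF]
  field_simp
  rw [hd, hg]
  ring

/-- Δ_z Γ̃₁(z,w) = (1-|z|²)·[G(z,w)+H₁(z,w)] for z ≠ w in the disk. -/
theorem statement6 :
    ∀ w ∈ unitDisk, ∀ z ∈ unitDisk, z ≠ w →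
      lapR (fun z => Gamma1 z w) z = (1 - ‖z‖ ^ 2) * (GreenG z w + H1 z w) := by
  intro w hw z hz hne
  have h0 : z - w ≠ 0 := sub_ne_zero.mpr hne
  have h1 := one_sub_ne hw hz
  have c0 : (starRingEnd ℂ) z - (starRingEnd ℂ) w ≠ 0 := by
    rw [← map_sub]; exact (map_ne_zero (starRingEnd ℂ)).mpr h0
  have c1 : 1 - (starRingEnd ℂ) z * w ≠ 0 := by
    have := (map_ne_zero (starRingEnd ℂ)).mpr h1
    simpa using this
  have hev : ∀ᶠ y in nhds z, HasWirt (fun z => (Gamma1 z w : ℂ))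
      (pz y ((starRingEnd ℂ) y) w ((starRingEnd ℂ) w) (GreenG y w))
      (pz ((starRingEnd ℂ) y) y ((starRingEnd ℂ) w) w (GreenG y w)) y := by
    have hU : unitDisk ∈ nhds z := Metric.isOpen_ball.mem_nhds hz
    filter_upwards [hU, eventually_ne_nhds hne] with y hy hyn
    exact wirt_gamma (sub_ne_zero.mpr hyn) (one_sub_ne hw hy)
  have hG := wirt_green h0 h1
  have I := HasWirt.id z
  have C := HasWirt.conj z
  have E1 := ((HasWirt.const 1 z).sub (I.mul (.const ((starRingEnd ℂ) w) z))).inv h1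
  have E2 := ((HasWirt.const 1 z).sub (C.mul (.const w z))).inv c1
  have hp := wirt_pz I C hG E1 E2
  have hq := wirt_pz C I hG E2 E1
  have hL := lapR_of_wirt hev hp hq
  have A := key_identity (L := GreenG z w) c0 h1 c1
  have B := key_identity (L := GreenG z w) h0 c1 h1
  rw [hL, ← Complex.ofReal_re ((1 - ‖z‖ ^ 2) * (GreenG z w + H1 z w))]
  congr 1
  unfold H1
  push_cast
  simp only [sq_norm_cast, re_cast]
  simp only [map_sub, map_mul, map_one, map_pow, map_div₀, Complex.conj_conj]
  simp only [mul_zero, zero_mul, mul_one, add_zero, zero_add, sub_zero, zero_sub, neg_zero,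
    neg_neg]
  rw [mul_comm ((starRingEnd ℂ) w) w] at B
  rw [A, B]
  ring

end
end

section
/- Fix λ ∈ D∖{0} and let φ_λ = φ_{λ,1} be the extremal function φ_λ(z) = (1 − (1−|λ|²)³)^{−1/2} · (1 − (1−|λ|²)³/(1 − z·conj(λ))³). Let u be a real-valued C²-smooth subharmonic function on D such that for some β with 0 < β < 2 there is a constant C with |u(z)| ≤ C·(1−|z|)^{−β} for all z ∈ D. Then ∫_D u(z)(1−|z|²) dΣ(z) ≤ ∫_D |φ_λ(z)|² u(z)(1−|z|²) dΣ(z). -/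
open Complex MeasureTheory Metric Set

noncomputable section

open Filter Topology

/-- Function of class C² on the disk with given Laplacian. -/
def LapOn (F L : ℂ → ℝ) : Prop :=
  ContDiffOn ℝ 2 F unitDisk ∧ ∀ z ∈ unitDisk, lapR F z = L z

lemma unitDisk_open : IsOpen unitDisk := Metric.isOpen_ball

lemma fderiv_dir_diff {F : ℂ → ℝ} {z : ℂ} (h : ContDiffAt ℝ 2 F z) (v : ℂ) :
    DifferentiableAt ℝ (fun w => fderiv ℝ F w v) z := by
  have h1 : ContDiffAt ℝ 1 (fderiv ℝ F) z := h.fderiv_right (by norm_num)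
  exact (h1.differentiableAt (by norm_num)).clm_apply (differentiableAt_const v)

lemma diff_ev {F : ℂ → ℝ} {z : ℂ} (h : ContDiffAt ℝ 2 F z) :
    ∀ᶠ w in 𝓝 z, DifferentiableAt ℝ F w := by
  filter_upwards [h.eventually (by norm_num)] with w hw
  exact hw.differentiableAt (by norm_num)

lemma lapR_add {F G : ℂ → ℝ} {z : ℂ} (hF : ContDiffAt ℝ 2 F z) (hG : ContDiffAt ℝ 2 G z) :
    lapR (fun w => F w + G w) z = lapR F z + lapR G z := by
  have key : ∀ v : ℂ, fderiv ℝ (fun w => fderiv ℝ (fun w => F w + G w) w v) z v =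
      fderiv ℝ (fun w => fderiv ℝ F w v) z v + fderiv ℝ (fun w => fderiv ℝ G w v) z v := by
    intro v
    have : (fun w => fderiv ℝ (fun w => F w + G w) w v) =ᶠ[𝓝 z]
        (fun w => fderiv ℝ F w v + fderiv ℝ G w v) := by
      filter_upwards [diff_ev hF, diff_ev hG] with w h1 h2
      rw [fderiv_fun_add h1 h2]; rfl
    rw [this.fderiv_eq, fderiv_fun_add (fderiv_dir_diff hF v) (fderiv_dir_diff hG v)]; rfl
  unfold lapR
  rw [key, key]; ring

lemma lapR_const_mul {F : ℂ → ℝ} {z : ℂ} (c : ℝ) (hF : ContDiffAt ℝ 2 F z) :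
    lapR (fun w => c * F w) z = c * lapR F z := by
  have key : ∀ v : ℂ, fderiv ℝ (fun w => fderiv ℝ (fun w => c * F w) w v) z v =
      c * fderiv ℝ (fun w => fderiv ℝ F w v) z v := by
    intro v
    have : (fun w => fderiv ℝ (fun w => c * F w) w v) =ᶠ[𝓝 z]
        (fun w => c * fderiv ℝ F w v) := by
      filter_upwards [diff_ev hF] with w h1
      rw [fderiv_const_mul (𝔸 := ℝ) h1]; rfl
    rw [this.fderiv_eq, fderiv_const_mul (𝔸 := ℝ) (fderiv_dir_diff hF v)]; rfl
  unfold lapR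
  rw [key, key]; ring

lemma lapR_congr {F G : ℂ → ℝ} {z : ℂ} (h : F =ᶠ[𝓝 z] G) : lapR F z = lapR G z := by
  have key : ∀ v : ℂ, fderiv ℝ (fun w => fderiv ℝ F w v) z v =
      fderiv ℝ (fun w => fderiv ℝ G w v) z v := by
    intro v
    have : (fun w => fderiv ℝ F w v) =ᶠ[𝓝 z] (fun w => fderiv ℝ G w v) := by
      filter_upwards [h.fderiv (𝕜 := ℝ)] with w h1
      rw [h1]
    rw [this.fderiv_eq]
  unfold lapR
  rw [key, key]

lemma lapR_scale (u : ℂ → ℝ) (r : ℝ) (z : ℂ) :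
    lapR (fun w => u (r • w)) z = r ^ 2 * lapR u (r • z) := by
  have key : ∀ v : ℂ, fderiv ℝ (fun w => fderiv ℝ (fun w => u (r • w)) w v) z v =
      r ^ 2 * fderiv ℝ (fun w => fderiv ℝ u w v) (r • z) v := by
    intro v
    have : (fun w => fderiv ℝ (fun w => u (r • w)) w v) =
        (fun w => r • (fun w => fderiv ℝ u w v) (r • w)) := by
      funext w
      rw [fderiv_comp_smul]; rfl
    rw [this]
    have h2 : fderiv ℝ (fun w => r • (fun w => fderiv ℝ u w v) (r • w)) z
        = r • fderiv ℝ (fun w => (fun w => fderiv ℝ u w v) (r • w)) z := by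
      exact congrFun (fderiv_const_smul_field (𝕜 := ℝ) (R := ℝ)
        (f := fun w => (fun w => fderiv ℝ u w v) (r • w)) r) z
    have h3 := fderiv_comp_smul (𝕜 := ℝ) (f := fun w => fderiv ℝ u w v) (x := z) r
    rw [h2, h3]
    simp [pow_two, mul_assoc]
  unfold lapR
  rw [key, key]; ring

lemma LapOn.add {F G L M : ℂ → ℝ} (hF : LapOn F L) (hG : LapOn G M) :
    LapOn (fun z => F z + G z) (fun z => L z + M z) := by
  refine ⟨hF.1.add hG.1, fun z hz => ?_⟩
  rw [lapR_add (hF.1.contDiffAt (unitDisk_open.mem_nhds hz))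
    (hG.1.contDiffAt (unitDisk_open.mem_nhds hz)), hF.2 z hz, hG.2 z hz]

lemma lapOn_pair {f g f' g' : ℂ → ℂ} (hf : ∀ z ∈ unitDisk, HasDerivAt f (f' z) z)
    (hg : ∀ z ∈ unitDisk, HasDerivAt g (g' z) z) :
    LapOn (fun z => (f z * (starRingEnd ℂ) (g z)).re)
      (fun z => (f' z * (starRingEnd ℂ) (g' z)).re) := by
  have hfd : DifferentiableOn ℂ f unitDisk :=
    fun z hz => (hf z hz).differentiableAt.differentiableWithinAt
  have hgd : DifferentiableOn ℂ g unitDisk :=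
    fun z hz => (hg z hz).differentiableAt.differentiableWithinAt
  have hf2 : ∀ z ∈ unitDisk, HasDerivAt f' (deriv f' z) z := by
    intro z hz
    have h1 : DifferentiableAt ℂ (deriv f) z :=
      (hfd.deriv unitDisk_open).differentiableAt (unitDisk_open.mem_nhds hz)
    have h2 : deriv f =ᶠ[𝓝 z] f' := by
      filter_upwards [unitDisk_open.mem_nhds hz] with w hw using (hf w hw).deriv
    exact (h1.congr_of_eventuallyEq h2.symm).hasDerivAt
  have hg2 : ∀ z ∈ unitDisk, HasDerivAt g' (deriv g' z) z := by
    intro z hz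
    have h1 : DifferentiableAt ℂ (deriv g) z :=
      (hgd.deriv unitDisk_open).differentiableAt (unitDisk_open.mem_nhds hz)
    have h2 : deriv g =ᶠ[𝓝 z] g' := by
      filter_upwards [unitDisk_open.mem_nhds hz] with w hw using (hg w hw).deriv
    exact (h1.congr_of_eventuallyEq h2.symm).hasDerivAt
  constructor
  · have h1 : ContDiffOn ℝ 2 f unitDisk := (hfd.contDiffOn unitDisk_open).restrict_scalars ℝ
    have h2 : ContDiffOn ℝ 2 g unitDisk := (hgd.contDiffOn unitDisk_open).restrict_scalars ℝ
    have h3 : ContDiffOn ℝ 2 (fun z => (starRingEnd ℂ) (g z)) unitDisk :=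
      (Complex.conjCLE.toContinuousLinearMap.contDiff (n := 2)).comp_contDiffOn h2
    exact (Complex.reCLM.contDiff (n := 2)).comp_contDiffOn (h1.mul h3)
  · intro z hz
    have base : ∀ (F G F' G' : ℂ → ℂ) (w v : ℂ), HasDerivAt F (F' w) w → HasDerivAt G (G' w) w →
        fderiv ℝ (fun z => (F z * (starRingEnd ℂ) (G z)).re) w v =
          (F' w * v * (starRingEnd ℂ) (G w) + F w * (starRingEnd ℂ) (G' w * v)).re ∧
        DifferentiableAt ℝ (fun z => (F z * (starRingEnd ℂ) (G z)).re) w := by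
      intro F G F' G' w v hF hG
      have a1 := hF.hasFDerivAt.restrictScalars ℝ
      have a2 := hG.hasFDerivAt.restrictScalars ℝ
      have a3 : HasFDerivAt (fun z => (starRingEnd ℂ) (G z)) _ w :=
        (Complex.conjCLE.toContinuousLinearMap.hasFDerivAt (x := G w)).comp w a2
      have a4 : HasFDerivAt (fun z => (F z * (starRingEnd ℂ) (G z)).re) _ w :=
        (Complex.reCLM.hasFDerivAt).comp w (a1.mul a3)
      refine ⟨?_, a4.differentiableAt⟩
      rw [a4.fderiv]
      simp
      ring
    have key : ∀ v : ℂ, fderiv ℝ (fun w => fderiv ℝ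
        (fun z => (f z * (starRingEnd ℂ) (g z)).re) w v) z v =
        (deriv f' z * v * v * (starRingEnd ℂ) (g z) + 
          2 * (f' z * (starRingEnd ℂ) (g' z) * (v * (starRingEnd ℂ) v))
          + f z * (starRingEnd ℂ) (deriv g' z * v * v)).re := by
      intro v
      have e : (fun w => fderiv ℝ (fun z => (f z * (starRingEnd ℂ) (g z)).re) w v) =ᶠ[𝓝 z]
          fun w => ((fun w => f' w * v) w * (starRingEnd ℂ) (g w)).re +
            (f w * (starRingEnd ℂ) ((fun w => g' w * v) w)).re := by
        filter_upwards [unitDisk_open.mem_nhds hz] with w hw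
        rw [(base f g f' g' w v (hf w hw) (hg w hw)).1, Complex.add_re]
      have b1 := base (fun w => f' w * v) g (fun w => deriv f' w * v) g' z v
        ((hf2 z hz).mul_const v) (hg z hz)
      have b2 := base f (fun w => g' w * v) f' (fun w => deriv g' w * v) z v
        (hf z hz) ((hg2 z hz).mul_const v)
      rw [e.fderiv_eq, fderiv_fun_add b1.2 b2.2, add_apply, b1.1, b2.1,
        ← Complex.add_re]
      congr 1
      simp only [map_mul]
      ring
    unfold lapR
    rw [key, key]
    simp [Complex.add_re, Complex.mul_re, Complex.mul_im]
    ring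

lemma hasDerivAt_max_pow (n : ℕ) (x : ℝ) :
    HasDerivAt (fun x : ℝ => (max x 0) ^ (n + 2)) ((n + 2 : ℝ) * (max x 0) ^ (n + 1)) x := by
  rcases lt_trichotomy x 0 with h | h | h
  · have : (fun x : ℝ => (max x 0) ^ (n + 2)) =ᶠ[𝓝 x] fun _ => 0 := by
      filter_upwards [Iio_mem_nhds h] with y hy
      rw [max_eq_right (le_of_lt hy)]; simp
    rw [max_eq_right h.le]
    simpa using (hasDerivAt_const x (0 : ℝ)).congr_of_eventuallyEq this
  · subst h
    simp only [max_self]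
    rw [hasDerivAt_iff_isLittleO]
    simp only [max_self, sub_zero, smul_eq_mul, ne_eq, Nat.add_eq_zero_iff, OfNat.ofNat_ne_zero,
      one_ne_zero, and_false, not_false_eq_true, zero_pow, mul_zero]
    have h1 : (fun x : ℝ => (max x 0) ^ (n + 2)) =O[𝓝 0] fun x : ℝ => x ^ (n + 2) := by
      refine Asymptotics.IsBigO.of_bound 1 (Eventually.of_forall fun y => ?_)
      rw [norm_pow, norm_pow, one_mul]
      gcongr
      simp only [Real.norm_eq_abs]
      rw [abs_of_nonneg (le_max_right y 0)]
      exact max_le (le_abs_self y) (abs_nonneg y)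
    refine h1.trans_isLittleO ?_
    simpa using (Asymptotics.isLittleO_pow_pow (𝕜 := ℝ) (m := 1) (n := n + 2) (by omega))
  · have : (fun x : ℝ => (max x 0) ^ (n + 2)) =ᶠ[𝓝 x] fun x => x ^ (n + 2) := by
      filter_upwards [Ioi_mem_nhds h] with y hy
      rw [max_eq_left (le_of_lt hy)]
    rw [max_eq_left h.le]
    have := (hasDerivAt_pow (n + 2) x).congr_of_eventuallyEq this
    rw [show ((n : ℝ) + 2) = ((n + 2 : ℕ) : ℝ) by push_cast; rfl]
    exact this

lemma contDiff_max_cube : ContDiff ℝ 2 (fun x : ℝ => (max x 0) ^ 3) := by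
  have h2 : ContDiff ℝ 1 (fun x : ℝ => (max x 0) ^ 2) := by
    rw [contDiff_one_iff_deriv]
    refine ⟨fun x => (hasDerivAt_max_pow 0 x).differentiableAt, ?_⟩
    have : deriv (fun x : ℝ => (max x 0) ^ 2) = fun x => ((0 : ℕ) + 2 : ℝ) * (max x 0) ^ (0 + 1) := by
      funext x; exact (hasDerivAt_max_pow 0 x).deriv
    rw [this]; fun_prop
  rw [show (2 : WithTop ℕ∞) = 1 + 1 from by norm_num, contDiff_succ_iff_deriv]
  refine ⟨fun x => (hasDerivAt_max_pow 1 x).differentiableAt, by simp, ?_⟩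
  have : deriv (fun x : ℝ => (max x 0) ^ 3) = fun x => ((1 : ℕ) + 2 : ℝ) * (max x 0) ^ (1 + 1) := by
    funext x; exact (hasDerivAt_max_pow 1 x).deriv
  rw [this]
  exact contDiff_const.mul h2

lemma green {P U : ℂ → ℝ} (hP : ContDiff ℝ 2 P) (hU : ContDiff ℝ 2 U)
    (hc : HasCompactSupport P) :
    ∫ z, lapR P z * U z = ∫ z, P z * lapR U z := by
  have d1 : ∀ {F : ℂ → ℝ}, ContDiff ℝ 2 F → ∀ v : ℂ, ContDiff ℝ 1 (fun z => fderiv ℝ F z v) :=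
    fun hF v => (hF.fderiv_right (m := 1) (by norm_num)).clm_apply contDiff_const
  have d2 : ∀ {F : ℂ → ℝ}, ContDiff ℝ 1 F → ∀ v : ℂ, Continuous (fun z => fderiv ℝ F z v) :=
    fun hF v => ((hF.continuous_fderiv (by norm_num)).clm_apply continuous_const)
  have sup1 : ∀ v : ℂ, HasCompactSupport (fun z => fderiv ℝ P z v) := fun v =>
    hc.fderiv_apply (𝕜 := ℝ) v
  have sup2 : ∀ v : ℂ, HasCompactSupport (fun z => fderiv ℝ (fun w => fderiv ℝ P w v) z v) :=
    fun v => (sup1 v).fderiv_apply (𝕜 := ℝ) v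
  have int : ∀ {F G : ℂ → ℝ}, Continuous F → Continuous G → HasCompactSupport F →
      Integrable (fun z => F z * G z) volume := fun hF hG hs =>
    (hF.mul hG).integrable_of_hasCompactSupport hs.mul_right
  have key : ∀ v : ℂ, ∫ z, fderiv ℝ (fun w => fderiv ℝ P w v) z v * U z =
      ∫ z, P z * fderiv ℝ (fun w => fderiv ℝ U w v) z v := by
    intro v
    have e1 := integral_mul_fderiv_eq_neg_fderiv_mul_of_integrable (μ := (volume : Measure ℂ))
      (f := P) (g := fun w => fderiv ℝ U w v) (v := v)
      (int (d1 hP v).continuous (d1 hU v).continuous (sup1 v))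
      (int hP.continuous (d2 (d1 hU v) v) hc)
      (int hP.continuous (d1 hU v).continuous hc)
      (fun x _ => (hP.differentiable (by norm_num)) x)
      (fun x _ => ((d1 hU v).differentiable (by norm_num)) x)
    have e2 := integral_mul_fderiv_eq_neg_fderiv_mul_of_integrable (μ := (volume : Measure ℂ))
      (f := fun w => fderiv ℝ P w v) (g := U) (v := v)
      (int (d2 (d1 hP v) v) hU.continuous (sup2 v))
      (int (d1 hP v).continuous (d1 hU v).continuous (sup1 v))
      (int (d1 hP v).continuous hU.continuous (sup1 v))
      (fun x _ => ((d1 hP v).differentiable (by norm_num)) x)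
      (fun x _ => (hU.differentiable (by norm_num)) x)
    rw [e1, e2, neg_neg]
  have e3 : ∀ z, lapR P z * U z = (1/4) * (fderiv ℝ (fun w => fderiv ℝ P w 1) z 1 * U z
    + fderiv ℝ (fun w => fderiv ℝ P w Complex.I) z Complex.I * U z) := by
    intro z; unfold lapR; ring
  have e4 : ∀ z, P z * lapR U z = (1/4) * (P z * fderiv ℝ (fun w => fderiv ℝ U w 1) z 1
    + P z * fderiv ℝ (fun w => fderiv ℝ U w Complex.I) z Complex.I) := by
    intro z; unfold lapR; ring
  simp_rw [e3, e4]
  rw [integral_const_mul, integral_const_mul, integral_add, integral_add, key, key]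
  · exact int hP.continuous (d2 (d1 hU _) _) hc
  · exact int hP.continuous (d2 (d1 hU _) _) hc
  · exact int (d2 (d1 hP _) _) hU.continuous (sup2 _)
  · exact int (d2 (d1 hP _) _) hU.continuous (sup2 _)

/-- The value of the potential without the cutoff. -/
def potQ (lam : ℂ) (z : ℂ) : ℝ :=
  (2 * normSq (1 - z * (starRingEnd ℂ) lam) + 2 - normSq lam - normSq lam * normSq z) /
    (normSq (1 - z * (starRingEnd ℂ) lam)) ^ 2

/-- The potential, extended by zero outside the disk. -/
def pot (lam : ℂ) (z : ℂ) : ℝ := (max (1 - normSq z) 0) ^ 3 * potQ lam z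

lemma normSq_lt_one {z : ℂ} (hz : z ∈ unitDisk) : normSq z < 1 := by
  have : ‖z‖ < 1 := by simpa [unitDisk] using hz
  rw [Complex.normSq_eq_norm_sq]
  nlinarith [norm_nonneg z]

lemma zeta_ne {lam z : ℂ} (hl : ‖lam‖ < 1) (hz : ‖z‖ ≤ 1) : 1 - z * (starRingEnd ℂ) lam ≠ 0 := by
  intro h
  have h1 : z * (starRingEnd ℂ) lam = 1 := (sub_eq_zero.mp h).symm
  have h2 : ‖z‖ * ‖lam‖ = 1 := by
    have := congrArg norm h1
    simpa using this
  nlinarith [norm_nonneg z, norm_nonneg lam]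

lemma contDiff_normSq : ContDiff ℝ 2 (fun z : ℂ => normSq z) := by
  have : (fun z : ℂ => normSq z) = fun z => z.re * z.re + z.im * z.im := by
    funext z; exact Complex.normSq_apply z
  rw [this]
  exact (Complex.reCLM.contDiff.mul Complex.reCLM.contDiff).add
    (Complex.imCLM.contDiff.mul Complex.imCLM.contDiff)

lemma pot_zero {lam z : ℂ} (hz : 1 ≤ ‖z‖) : pot lam z = 0 := by
  unfold pot
  have : 1 - normSq z ≤ 0 := by rw [Complex.normSq_eq_norm_sq]; nlinarith
  rw [max_eq_right this]; simp

lemma pot_nonneg {lam : ℂ} (hl : ‖lam‖ < 1) (z : ℂ) : 0 ≤ pot lam z := by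
  by_cases hz : 1 ≤ ‖z‖
  · rw [pot_zero hz]
  · push Not at hz
    unfold pot potQ
    refine mul_nonneg (by positivity) (div_nonneg ?_ (by positivity))
    have h1 : normSq lam ≤ 1 := by rw [Complex.normSq_eq_norm_sq]; nlinarith [norm_nonneg lam]
    have h2 : normSq z ≤ 1 := by rw [Complex.normSq_eq_norm_sq]; nlinarith [norm_nonneg z]
    nlinarith [normSq_nonneg lam, normSq_nonneg z, normSq_nonneg (1 - z * (starRingEnd ℂ) lam)]

lemma pot_contDiff {lam : ℂ} (hl : ‖lam‖ < 1) : ContDiff ℝ 2 (pot lam) := by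
  rw [contDiff_iff_contDiffAt]
  intro z
  by_cases hz : 1 < ‖z‖
  · have : pot lam =ᶠ[𝓝 z] fun _ => 0 := by
      filter_upwards [(isOpen_lt continuous_const continuous_norm).mem_nhds hz] with w hw
      exact pot_zero (le_of_lt hw)
    exact contDiffAt_const.congr_of_eventuallyEq this
  · push Not at hz
    have h0 : normSq (1 - z * (starRingEnd ℂ) lam) ≠ 0 :=
      fun h => zeta_ne hl hz (normSq_eq_zero.mp h)
    have hD : ContDiff ℝ 2 (fun z : ℂ => normSq (1 - z * (starRingEnd ℂ) lam)) :=
      contDiff_normSq.comp (contDiff_const.sub (contDiff_id.mul contDiff_const))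
    have h1 : ContDiff ℝ 2 (fun z : ℂ => (max (1 - normSq z) 0) ^ 3) :=
      contDiff_max_cube.comp (contDiff_const.sub contDiff_normSq)
    refine h1.contDiffAt.mul (ContDiffAt.div ?_ (hD.pow 2).contDiffAt (pow_ne_zero 2 h0))
    exact ((((contDiff_const.mul hD).add contDiff_const).sub contDiff_const).sub
      (contDiff_const.mul contDiff_normSq)).contDiffAt

lemma pot_support (lam : ℂ) : HasCompactSupport (pot lam) := by
  refine HasCompactSupport.intro (isCompact_closedBall (0 : ℂ) 1) fun z hz => ?_
  refine pot_zero ?_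
  simp at hz
  exact hz.le

lemma lapR_pot_zero {lam z : ℂ} (hz : 1 < ‖z‖) : lapR (pot lam) z = 0 := by
  have : pot lam =ᶠ[𝓝 z] fun _ => 0 := by
    filter_upwards [(isOpen_lt continuous_const continuous_norm).mem_nhds hz] with w hw
    exact pot_zero (le_of_lt hw)
  rw [lapR_congr this]
  simp [lapR]


lemma LapOn.congr {F G L : ℂ → ℝ} (hF : LapOn F L) (h : ∀ w ∈ unitDisk, F w = G w) :
    ∀ z ∈ unitDisk, lapR G z = L z := by
  intro z hz
  rw [← hF.2 z hz]
  apply lapR_congr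
  filter_upwards [unitDisk_open.mem_nhds hz] with w hw using (h w hw).symm

lemma pot_ident (z zc a ac : ℂ) (ζ η : ℂ) (h : ζ ≠ 0) (hc : η ≠ 0)
    (e : ζ = 1 - z * a) (ec : η = 1 - zc * ac) :
    (ac - z) / ζ * ((a - zc) / η)
    + (-(1/4) * ((ac - z) / ζ) ^ 2) * ((a - zc) / η) ^ 2
    + z * zc + (-(1/4) * z ^ 2) * zc ^ 2
    + (1/2) * ((-(z * ζ + z) / ζ ^ 2) * zc
       + (-(zc * η + zc) / η ^ 2) * z)
    + (1/2) * ((z ^ 2 / (2 * ζ ^ 2)) * zc ^ 2 + (zc ^ 2 / (2 * η ^ 2)) * z ^ 2)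
    + (1/2) * (((ζ + 1/2) / ζ ^ 2 - 3/2)
      + ((η + 1/2) / η ^ 2 - 3/2)) =
    (1/4) * (a * ac) * ((1 - z * zc) ^ 3 *
      ((2 * (ζ * η) + 2 - a * ac - a * ac * (z * zc)) /
        (ζ * η) ^ 2)) := by
  field_simp
  rw [e, ec]
  ring

lemma lap_ident (z zc a ac : ℂ) (ζ η : ℂ) (h : ζ ≠ 0) (hc : η ≠ 0)
    (e : ζ = 1 - z * a) (ec : η = 1 - zc * ac) :
    (1 - a * ac) ^ 3 * (
    (-(1 - a * ac) / ζ ^ 2) * (-(1 - a * ac) / η ^ 2)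
    + (-(1/4) * (2 * ((ac - z) / ζ) * (-(1 - a * ac) / ζ ^ 2))) *
       (2 * ((a - zc) / η) * (-(1 - a * ac) / η ^ 2))
    + 1 + (-(1/4) * (2 * z)) * (2 * zc)
    + (1/2) * (-2 / ζ ^ 3 + -2 / η ^ 3)
    + (1/2) * ((z / ζ ^ 3) * (2 * zc) + (zc / η ^ 3) * (2 * z))) =
    ((1 - (1 - a * ac) ^ 3 / ζ ^ 3) * (1 - (1 - a * ac) ^ 3 / η ^ 3)
      - (1 - (1 - a * ac) ^ 3)) * (1 - z * zc) := by
  field_simp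
  rw [e, ec]
  ring

lemma lapR_pot {lam z : ℂ} (hl : ‖lam‖ < 1) (hz : z ∈ unitDisk) :
    (1 - normSq lam) ^ 3 * (normSq lam / 4 * lapR (pot lam) z) =
      (normSq (1 - (((1 - normSq lam) ^ 3 : ℝ) : ℂ) / (1 - z * (starRingEnd ℂ) lam) ^ 3)
        - (1 - (1 - normSq lam) ^ 3)) * (1 - normSq z) := by
  set a := (starRingEnd ℂ) lam with ha
  have hla : (starRingEnd ℂ) a = lam := by simp [ha]
  have hnz : ∀ w ∈ unitDisk, 1 - w * a ≠ 0 := fun w hw =>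
    zeta_ne hl (by have : ‖w‖ < 1 := by simpa [unitDisk] using hw
                   exact this.le)
  have hid : ∀ w : ℂ, HasDerivAt (fun w : ℂ => w) 1 w := fun w => hasDerivAt_id w
  have hsq : ∀ w : ℂ, HasDerivAt (fun w : ℂ => w ^ 2) (2 * w) w := fun w => by
    simpa using hasDerivAt_pow 2 w
  have hzeta : ∀ w : ℂ, HasDerivAt (fun w : ℂ => 1 - w * a) (-a) w := fun w => by
    simpa using ((hid w).mul_const a).const_sub 1
  have hzeta2 : ∀ w : ℂ, HasDerivAt (fun w : ℂ => (1 - w * a) ^ 2) (2 * (1 - w * a) * (-a)) w :=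
    fun w => by simpa using (hzeta w).fun_pow 2
  have hb : ∀ w ∈ unitDisk, HasDerivAt (fun w => (lam - w) / (1 - w * a))
      (-(1 - a * lam) / (1 - w * a) ^ 2) w := by
    intro w hw
    have h0 := hnz w hw
    have := ((hid w).const_sub lam).div (hzeta w) (hnz w hw)
    refine this.congr_deriv ?_
    field_simp
    ring
  have hb2 : ∀ w ∈ unitDisk, HasDerivAt (fun w => ((lam - w) / (1 - w * a)) ^ 2)
      (2 * ((lam - w) / (1 - w * a)) * (-(1 - a * lam) / (1 - w * a) ^ 2)) w := by
    intro w hw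
    simpa using (hb w hw).fun_pow 2
  have h5 : ∀ w ∈ unitDisk, HasDerivAt (fun w => -(w * (1 - w * a) + w) / (1 - w * a) ^ 2)
      (-2 / (1 - w * a) ^ 3) w := by
    intro w hw
    have h0 := hnz w hw
    have := ((((hid w).mul (hzeta w)).add (hid w)).neg).div (hzeta2 w) (pow_ne_zero 2 (hnz w hw))
    refine this.congr_deriv ?_
    simp only [Pi.add_apply, Pi.mul_apply, Pi.neg_apply]
    field_simp
    ring
  have h6 : ∀ w ∈ unitDisk, HasDerivAt (fun w => w ^ 2 / (2 * (1 - w * a) ^ 2))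
      (w / (1 - w * a) ^ 3) w := by
    intro w hw
    have h0 := hnz w hw
    have := (hsq w).div ((hzeta2 w).const_mul 2) (mul_ne_zero two_ne_zero (pow_ne_zero 2 (hnz w hw)))
    refine this.congr_deriv ?_
    field_simp
    ring
  have h7 : ∀ w ∈ unitDisk, HasDerivAt (fun w => ((1 - w * a) + 1/2) / (1 - w * a) ^ 2 - 3/2)
      (a / (1 - w * a) ^ 2 + a / (1 - w * a) ^ 3) w := by
    intro w hw
    have h0 := hnz w hw
    have := (((hzeta w).add_const (1/2)).div (hzeta2 w) (pow_ne_zero 2 (hnz w hw))).sub_const (3/2)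
    refine this.congr_deriv ?_
    field_simp
    ring
  have L1 := lapOn_pair hb hb
  have L2 := lapOn_pair (fun w hw => (hb2 w hw).const_mul (-(1/4) : ℂ)) hb2
  have L3 := lapOn_pair (fun w _ => hid w) (fun w _ => hid w)
  have L4 := lapOn_pair (fun w _ => (hsq w).const_mul (-(1/4) : ℂ)) (fun w _ => hsq w)
  have L5 := lapOn_pair h5 (fun w _ => hid w)
  have L6 := lapOn_pair h6 (fun w _ => hsq w)
  have L7 := lapOn_pair h7 (fun w _ => hasDerivAt_const w (1 : ℂ))
  have LL := (((((L1.add L2).add L3).add L4).add L5).add L6).add L7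
  have re_eq : ∀ x : ℂ, (x.re : ℂ) = (1/2) * (x + (starRingEnd ℂ) x) := fun x => by
    rw [Complex.add_conj]; push_cast; ring
  have E := LL.congr (G := fun w => normSq lam / 4 * pot lam w) (fun w hw => by
    have h0 := hnz w hw
    have h0c : 1 - (starRingEnd ℂ) w * lam ≠ 0 := by
      have := (map_ne_zero (starRingEnd ℂ)).mpr h0
      simpa [hla] using this
    have key := pot_ident w ((starRingEnd ℂ) w) a lam _ _ h0 h0c rfl rfl
    have hmax : max (1 - normSq w) 0 = 1 - normSq w :=
      max_eq_left (by linarith [normSq_lt_one hw])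
    apply Complex.ofReal_injective
    unfold pot potQ
    rw [hmax]
    push_cast
    simp only [← Complex.mul_conj, re_eq, map_mul, map_div₀, map_sub, map_one, map_pow, map_neg,
      map_add, Complex.conj_conj, map_ofNat, hla, ← ha]
    rw [show lam * a / 4 = (1/4) * (a * lam) by ring, mul_comm lam a, ← key]
    ring) z hz
  rw [← lapR_const_mul _ (pot_contDiff hl).contDiffAt, E]
  have h0 := hnz z hz
  have h0c : 1 - (starRingEnd ℂ) z * lam ≠ 0 := by
    have := (map_ne_zero (starRingEnd ℂ)).mpr h0
    simpa [hla] using this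
  have key := lap_ident z ((starRingEnd ℂ) z) a lam _ _ h0 h0c rfl rfl
  apply Complex.ofReal_injective
  push_cast
  simp only [← Complex.mul_conj, re_eq, map_mul, map_div₀, map_sub, map_one, map_pow, map_neg,
      map_add, Complex.conj_conj, map_ofNat, hla, ← ha, map_zero]
  rw [mul_comm lam a]
  rw [← key]
  ring

lemma main_r {lam : ℂ} (hl : ‖lam‖ < 1) {u : ℂ → ℝ} (hu : ContDiffOn ℝ 2 u unitDisk)
    (husub : ∀ z ∈ unitDisk, 0 ≤ lapR u z) {r : ℝ} (hr0 : 0 < r) (hr1 : r < 1) :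
    0 ≤ ∫ z in unitDisk, lapR (pot lam) z * u (r • z) := by
  have hR : 1 < 1 / r := by rw [lt_div_iff₀ hr0]; linarith
  let χ : ContDiffBump (0 : ℂ) := ⟨1, (1 + 1 / r) / 2, one_pos, by linarith⟩
  set U : ℂ → ℝ := fun z => χ z * u (r • z) with hUdef
  have hmem : ∀ z : ℂ, ‖z‖ < 1 / r → r • z ∈ unitDisk := by
    intro z hz
    rw [lt_div_iff₀ hr0] at hz
    simp only [unitDisk, mem_ball_zero_iff, norm_smul, Real.norm_eq_abs, abs_of_pos hr0]
    linarith
  have hU : ContDiff ℝ 2 U := by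
    rw [contDiff_iff_contDiffAt]
    intro z
    by_cases hz : ‖z‖ < 1 / r
    · have h1 : ContDiffAt ℝ 2 u (r • z) := hu.contDiffAt (unitDisk_open.mem_nhds (hmem z hz))
      have h2 : ContDiffAt ℝ 2 (fun z : ℂ => r • z) z := (contDiff_const_smul r).contDiffAt
      exact χ.contDiffAt.mul (ContDiffAt.comp z h1 h2)
    · have hz' : (1 + 1 / r) / 2 < ‖z‖ := by push Not at hz; linarith
      have : U =ᶠ[𝓝 z] fun _ => 0 := by
        filter_upwards [(isOpen_lt continuous_const continuous_norm).mem_nhds hz'] with w hw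
        have hw' : (1 + 1 / r) / 2 < ‖w‖ := hw
        have : χ w = 0 := χ.zero_of_le_dist (by rw [dist_zero_right]; exact hw'.le)
        simp [hUdef, this]
      exact contDiffAt_const.congr_of_eventuallyEq this
  have hUeq : ∀ z ∈ unitDisk, U z = u (r • z) := by
    intro z hz
    have : χ z = 1 := χ.one_of_mem_closedBall (ball_subset_closedBall hz)
    simp [hUdef, this]
  have e1 : ∫ z in unitDisk, lapR (pot lam) z * u (r • z) = ∫ z, lapR (pot lam) z * U z := by
    rw [← setIntegral_eq_integral_of_ae_compl_eq_zero (μ := (volume : Measure ℂ)) (s := unitDisk)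
      (f := fun z => lapR (pot lam) z * U z)]
    · refine setIntegral_congr_fun unitDisk_open.measurableSet fun z hz => ?_
      simp only [hUeq z hz]
    · have hs : ∀ᵐ z : ℂ, z ∉ Metric.sphere (0 : ℂ) 1 := by
        rw [← measure_eq_zero_iff_ae_notMem]
        exact Measure.addHaar_sphere _ _ _
      filter_upwards [hs] with z hz hz2
      have h1 : ‖z‖ ≠ 1 := by simpa using hz
      have h2 : 1 ≤ ‖z‖ := by simpa [unitDisk] using hz2
      rw [lapR_pot_zero (lt_of_le_of_ne h2 (Ne.symm h1)), zero_mul]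
  rw [e1, green (pot_contDiff hl) hU (pot_support lam)]
  refine integral_nonneg fun z => ?_
  show 0 ≤ pot lam z * lapR U z
  by_cases hz : z ∈ unitDisk
  · refine mul_nonneg (pot_nonneg hl z) ?_
    have : U =ᶠ[𝓝 z] fun w => u (r • w) := by
      filter_upwards [unitDisk_open.mem_nhds hz] with w hw using hUeq w hw
    rw [lapR_congr this, lapR_scale]
    refine mul_nonneg (by positivity) (husub _ (hmem z ?_))
    have : ‖z‖ < 1 := by simpa [unitDisk] using hz
    linarith
  · rw [pot_zero (by simpa [unitDisk] using hz), zero_mul]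

lemma bound_int {β : ℝ} (hβ2 : β < 2) :
    IntegrableOn (fun z : ℂ => (1 - ‖z‖) ^ (1 - β)) unitDisk := by
  unfold unitDisk
  rw [integrableOn_fun_norm_addHaar (μ := (volume : Measure ℂ)) (f := fun y => (1 - y) ^ (1 - β))]
  have h1 : IntervalIntegrable (fun y : ℝ => (1 - y) ^ (1 - β)) volume 0 1 := by
    have := (intervalIntegral.intervalIntegrable_rpow' (a := 1) (b := 0) (r := 1 - β)
      (by linarith)).comp_sub_left 1
    simpa using this
  rw [intervalIntegrable_iff_integrableOn_Ioo_of_le zero_le_one] at h1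
  simp only [Complex.finrank_real_complex, smul_eq_mul]
  refine Integrable.bdd_mul (c := 1) h1 (by fun_prop) ?_
  filter_upwards [ae_restrict_mem measurableSet_Ioo] with y hy
  simp
  rw [abs_of_pos hy.1]; exact hy.2.le

lemma dom_bound {H u : ℂ → ℝ} {β C M r : ℝ} (hβ0 : 0 < β)
    (hM : ∀ z ∈ unitDisk, |H z| ≤ M)
    (hgrowth : ∀ z ∈ unitDisk, |u z| ≤ C * (1 - ‖z‖) ^ (-β)) (hr0 : 0 < r) (hr1 : r ≤ 1)
    {z : ℂ} (hz : z ∈ unitDisk) :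
    ‖H z * (1 - ‖z‖ ^ 2) * u (r • z)‖ ≤ 2 * M * C * (1 - ‖z‖) ^ (1 - β) := by
  have hz1 : ‖z‖ < 1 := by simpa [unitDisk] using hz
  have hC : 0 ≤ C := by
    have := hgrowth 0 (by simp [unitDisk])
    simp at this
    exact (abs_nonneg _).trans this
  have hM0 : 0 ≤ M := (abs_nonneg _).trans (hM z hz)
  have hrz : ‖r • z‖ ≤ ‖z‖ := by
    rw [norm_smul, Real.norm_eq_abs, abs_of_pos hr0]
    nlinarith [norm_nonneg z]
  have h1 : |u (r • z)| ≤ C * (1 - ‖z‖) ^ (-β) := by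
    refine (hgrowth _ (by simp only [unitDisk, mem_ball_zero_iff]; linarith)).trans ?_
    refine mul_le_mul_of_nonneg_left ?_ hC
    exact Real.rpow_le_rpow_of_nonpos (by linarith) (by linarith) (by linarith)
  have h2 : |1 - ‖z‖ ^ 2| ≤ 2 * (1 - ‖z‖) := by
    rw [abs_of_nonneg (by nlinarith [norm_nonneg z])]
    nlinarith [norm_nonneg z]
  have h3 : (1 - ‖z‖) ^ (1 - β) = (1 - ‖z‖) * (1 - ‖z‖) ^ (-β) := by
    rw [sub_eq_add_neg 1 β, Real.rpow_add (by linarith), Real.rpow_one]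
  rw [Real.norm_eq_abs, abs_mul, abs_mul, h3]
  calc |H z| * |1 - ‖z‖ ^ 2| * |u (r • z)|
      ≤ M * (2 * (1 - ‖z‖)) * (C * (1 - ‖z‖) ^ (-β)) := by
        gcongr
        exact hM z hz
    _ = _ := by ring

lemma smul_mem_disk {r : ℝ} (hr0 : 0 < r) (hr1 : r ≤ 1) {z : ℂ} (hz : z ∈ unitDisk) :
    r • z ∈ unitDisk := by
  have hz1 : ‖z‖ < 1 := by simpa [unitDisk] using hz
  simp only [unitDisk, mem_ball_zero_iff]
  rw [norm_smul, Real.norm_eq_abs, abs_of_pos hr0]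
  nlinarith [norm_nonneg z]

lemma meas_aux {H u : ℂ → ℝ} (hH : ContinuousOn H closedDisk) (hu : ContinuousOn u unitDisk)
    {r : ℝ} (hr0 : 0 < r) (hr1 : r ≤ 1) :
    AEStronglyMeasurable (fun z => H z * (1 - ‖z‖ ^ 2) * u (r • z)) (volume.restrict unitDisk) := by
  refine ContinuousOn.aestronglyMeasurable ?_ unitDisk_open.measurableSet
  refine ((hH.mono ball_subset_closedBall).mul (by fun_prop)).mul ?_
  exact hu.comp (by fun_prop) fun z hz => smul_mem_disk hr0 hr1 hz

lemma exists_bd {H : ℂ → ℝ} (hH : ContinuousOn H closedDisk) :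
    ∃ M, ∀ z ∈ unitDisk, |H z| ≤ M := by
  obtain ⟨M, hM⟩ := (isCompact_closedBall (0 : ℂ) 1).exists_bound_of_continuousOn hH
  exact ⟨M, fun z hz => hM z (ball_subset_closedBall hz)⟩

lemma int_aux {H u : ℂ → ℝ} {β C : ℝ} (hβ0 : 0 < β) (hβ2 : β < 2)
    (hH : ContinuousOn H closedDisk) (hu : ContinuousOn u unitDisk)
    (hgrowth : ∀ z ∈ unitDisk, |u z| ≤ C * (1 - ‖z‖) ^ (-β)) :
    IntegrableOn (fun z => H z * (1 - ‖z‖ ^ 2) * u z) unitDisk := by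
  obtain ⟨M, hM⟩ := exists_bd hH
  refine Integrable.mono' ((bound_int hβ2).const_mul (2 * M * C)) ?_ ?_
  · simpa using meas_aux hH hu one_pos le_rfl
  · filter_upwards [ae_restrict_mem unitDisk_open.measurableSet] with z hz
    simpa using dom_bound hβ0 hM hgrowth one_pos le_rfl hz

lemma lim_aux {H u : ℂ → ℝ} {β C : ℝ} (hβ0 : 0 < β) (hβ2 : β < 2)
    (hH : ContinuousOn H closedDisk) (hu : ContinuousOn u unitDisk)
    (hgrowth : ∀ z ∈ unitDisk, |u z| ≤ C * (1 - ‖z‖) ^ (-β))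
    (hpos : ∀ r : ℝ, 0 < r → r < 1 →
      0 ≤ ∫ z in unitDisk, H z * (1 - ‖z‖ ^ 2) * u (r • z)) :
    0 ≤ ∫ z in unitDisk, H z * (1 - ‖z‖ ^ 2) * u z := by
  obtain ⟨M, hM⟩ := exists_bd hH
  have hev : ∀ᶠ r : ℝ in 𝓝[<] 1, 0 < r ∧ r < 1 := by
    filter_upwards [Ioo_mem_nhdsLT (zero_lt_one' ℝ)] with r hr using hr
  have ht : Tendsto (fun r : ℝ => ∫ z in unitDisk, H z * (1 - ‖z‖ ^ 2) * u (r • z)) (𝓝[<] 1)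
      (𝓝 (∫ z in unitDisk, H z * (1 - ‖z‖ ^ 2) * u z)) := by
    refine tendsto_integral_filter_of_dominated_convergence
      (fun z => 2 * M * C * (1 - ‖z‖) ^ (1 - β)) ?_ ?_ ((bound_int hβ2).const_mul _) ?_
    · filter_upwards [hev] with r hr using meas_aux hH hu hr.1 hr.2.le
    · filter_upwards [hev] with r hr
      filter_upwards [ae_restrict_mem unitDisk_open.measurableSet] with z hz
      exact dom_bound hβ0 hM hgrowth hr.1 hr.2.le hz
    · filter_upwards [ae_restrict_mem unitDisk_open.measurableSet] with z hz
      refine Tendsto.const_mul _ ?_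
      have h1 : Tendsto u (𝓝 z) (𝓝 (u z)) := hu.continuousAt (unitDisk_open.mem_nhds hz)
      have h2 : Tendsto (fun r : ℝ => r • z) (𝓝[<] 1) (𝓝 z) := by
        have : Tendsto (fun r : ℝ => r • z) (𝓝 1) (𝓝 ((1 : ℝ) • z)) :=
          (continuous_id.smul continuous_const).tendsto 1
        rw [one_smul] at this
        exact this.mono_left nhdsWithin_le_nhds
      exact h1.comp h2
  refine ge_of_tendsto ht ?_
  filter_upwards [hev] with r hr using hpos r hr.1 hr.2

/-- the extremal function φ_{λ,1} for A²₁(𝔻) is an expansive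
multiplier on C²-smooth subharmonic functions with moderate boundary growth. -/
theorem statement7 (lam : ℂ) (hlam : lam ∈ unitDisk) (hlam0 : lam ≠ 0)
    (φ : ℂ → ℂ)
    (hφ : ∀ z : ℂ, φ z =
      (((1 - (1 - ‖lam‖ ^ 2) ^ 3) ^ (-(1 / 2) : ℝ) : ℝ) : ℂ) *
        (1 - (((1 - ‖lam‖ ^ 2) ^ 3 : ℝ) : ℂ) /
          (1 - z * (starRingEnd ℂ) lam) ^ 3))
    (u : ℂ → ℝ) (hu : ContDiffOn ℝ 2 u unitDisk)
    (husub : ∀ z ∈ unitDisk, 0 ≤ lapR u z)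
    (β C : ℝ) (hβ0 : 0 < β) (hβ2 : β < 2)
    (hgrowth : ∀ z ∈ unitDisk, |u z| ≤ C * (1 - ‖z‖) ^ (-β)) :
    ∫ z in unitDisk, u z * (1 - ‖z‖ ^ 2) ∂dSigma ≤
      ∫ z in unitDisk, ‖φ z‖ ^ 2 * u z * (1 - ‖z‖ ^ 2) ∂dSigma := by
  have hl : ‖lam‖ < 1 := by simpa [unitDisk] using hlam
  have hl0 : 0 < ‖lam‖ := norm_pos_iff.mpr hlam0
  set s : ℝ := 1 - ‖lam‖ ^ 2 with hs
  have hs0 : 0 < s := by rw [hs]; nlinarith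
  have hs1 : s < 1 := by rw [hs]; nlinarith
  have hs3 : 0 < 1 - s ^ 3 := by
    have : s ^ 3 < 1 := pow_lt_one₀ hs0.le hs1 (by norm_num)
    linarith
  have hns : 1 - normSq lam = s := by rw [Complex.normSq_eq_norm_sq]
  have hφn : ∀ z, ‖φ z‖ ^ 2 = (1 - s ^ 3)⁻¹ *
      normSq (1 - ((s ^ 3 : ℝ) : ℂ) / (1 - z * (starRingEnd ℂ) lam) ^ 3) := by
    intro z
    rw [hφ z, norm_mul, mul_pow, ← Complex.normSq_eq_norm_sq (1 - _), Complex.norm_real,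
      Real.norm_eq_abs, sq_abs, ← Real.rpow_natCast, ← Real.rpow_mul hs3.le]
    congr 1
    rw [show (-(1 / 2) : ℝ) * ((2 : ℕ) : ℝ) = -1 by norm_num, Real.rpow_neg_one]
  have hφc : ContinuousOn (fun z => ‖φ z‖ ^ 2) closedDisk := by
    have : (fun z => ‖φ z‖ ^ 2) = fun z => ‖(((1 - s ^ 3) ^ (-(1 / 2) : ℝ) : ℝ) : ℂ) *
        (1 - ((s ^ 3 : ℝ) : ℂ) / (1 - z * (starRingEnd ℂ) lam) ^ 3)‖ ^ 2 := by
      funext z; rw [hφ z]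
    rw [this]
    refine (ContinuousOn.norm ?_).pow 2
    refine continuousOn_const.mul (continuousOn_const.sub (continuousOn_const.div (by fun_prop) ?_))
    intro z hz
    exact pow_ne_zero 3 (zeta_ne hl (by simpa [closedDisk] using hz))
  have hHc : ContinuousOn (fun z => ‖φ z‖ ^ 2 - 1) closedDisk := hφc.sub continuousOn_const
  have hW : ∀ z ∈ unitDisk, (‖φ z‖ ^ 2 - 1) * (1 - ‖z‖ ^ 2) =
      ((1 - s ^ 3)⁻¹ * (s ^ 3 * (normSq lam / 4))) * lapR (pot lam) z := by
    intro z hz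
    have h := lapR_pot hl hz
    rw [hns] at h
    rw [mul_assoc, mul_assoc, h, hφn z, ← Complex.normSq_eq_norm_sq z]
    field_simp
  have hfin : 0 ≤ ∫ z in unitDisk, (‖φ z‖ ^ 2 - 1) * (1 - ‖z‖ ^ 2) * u z := by
    refine lim_aux hβ0 hβ2 hHc hu.continuousOn hgrowth fun r hr0 hr1 => ?_
    have : ∫ z in unitDisk, (‖φ z‖ ^ 2 - 1) * (1 - ‖z‖ ^ 2) * u (r • z) =
        ∫ z in unitDisk, ((1 - s ^ 3)⁻¹ * (s ^ 3 * (normSq lam / 4))) *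
          (lapR (pot lam) z * u (r • z)) := by
      refine setIntegral_congr_fun unitDisk_open.measurableSet fun z hz => ?_
      simp only [hW z hz]
      ring
    rw [this, integral_const_mul]
    refine mul_nonneg ?_ (main_r hl hu husub hr0 hr1)
    have := normSq_nonneg lam
    positivity
  have i1 : IntegrableOn (fun z => u z * (1 - ‖z‖ ^ 2)) unitDisk := by
    have := int_aux (H := fun _ => 1) hβ0 hβ2 continuousOn_const hu.continuousOn hgrowth
    refine this.congr_fun (fun z _ => ?_) unitDisk_open.measurableSet
    simp only; ring
  have i2 : IntegrableOn (fun z => ‖φ z‖ ^ 2 * u z * (1 - ‖z‖ ^ 2)) unitDisk := by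
    have := int_aux hβ0 hβ2 hφc hu.continuousOn hgrowth
    refine this.congr_fun (fun z _ => ?_) unitDisk_open.measurableSet
    simp only; ring
  have hsub : ∫ z in unitDisk, (‖φ z‖ ^ 2 - 1) * (1 - ‖z‖ ^ 2) * u z =
      (∫ z in unitDisk, ‖φ z‖ ^ 2 * u z * (1 - ‖z‖ ^ 2)) -
        ∫ z in unitDisk, u z * (1 - ‖z‖ ^ 2) := by
    rw [← integral_sub i2 i1]
    congr 1
    funext z
    ring
  rw [hsub] at hfin
  simp only [dSigma, Measure.restrict_smul, integral_smul_measure, smul_eq_mul]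
  exact mul_le_mul_of_nonneg_left (by linarith) ENNReal.toReal_nonneg


end
end
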